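/- Let k ≥ 2 and r ≥ 0 be integers and let G be a 2-connected graph with minimum degree at least k−r. If G does not contain k admissible cycles, then every vertex cut S of G satisfies 2|S| ≥ k+2−2r; that is, the connectivity of G is at least (k+2)/2 − r. -/

import Mathlib

open SimpleGraph

/-- `G` has a cycle of length `n`. -/
def HasCycleLen {V : Type*} (G : SimpleGraph V) (n : ℕ) : Prop :=
  ∃ (v : V) (c : G.Walk v v), c.IsCycle ∧ c.length = n

/-- `G` has a cycle whose length is congruent to `l` modulo `k`. -/
def HasCycleLenMod {V : Type*} (G : SimpleGraph V) (k : ℕ) (l : ℤ) : Prop :=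
  ∃ n : ℕ, HasCycleLen G n ∧ (n : ℤ) ≡ l [ZMOD (k : ℤ)]

/-- `G` is `t`-connected: it has at least `t+1` vertices and the deletion of any set
of at most `t-1` vertices leaves a connected graph. -/
def KConnected {V : Type*} [Fintype V] (G : SimpleGraph V) (t : ℕ) : Prop :=
  t + 1 ≤ Fintype.card V ∧
    ∀ S : Finset V, S.card ≤ t - 1 → (G.induce ((↑S : Set V)ᶜ)).Connected

/-- `G` contains `k` admissible cycles: `k` cycles whose lengths form an arithmetic
progression with common difference 1 or 2. -/
def HasAdmissibleCycles {V : Type*} (G : SimpleGraph V) (k : ℕ) : Prop :=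
  ∃ a d : ℕ, (d = 1 ∨ d = 2) ∧ ∀ i < k, HasCycleLen G (a + i * d)

/-- A finite set `S` of vertices is a vertex cut of `G` if deleting `S` leaves a
disconnected graph. -/
def IsVertexCut {V : Type*} (G : SimpleGraph V) (S : Finset V) : Prop :=
  ¬ (G.induce ((↑S : Set V)ᶜ)).Connected

set_option linter.unusedSectionVars false

section PathsInSets

variable {V : Type*} [DecidableEq V]

/-- `PathIn G A u v n`: there is a path of length `n` from `u` to `v` in `G` all of whose
vertices lie in `A`. -/
inductive PathIn (G : SimpleGraph V) : Finset V → V → V → ℕ → Prop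
  | nil {A : Finset V} {u : V} (hu : u ∈ A) : PathIn G A u u 0
  | cons {A : Finset V} {u w v : V} {n : ℕ} (hu : u ∈ A) (h : G.Adj u w)
      (p : PathIn G (A.erase u) w v n) : PathIn G A u v (n + 1)

namespace PathIn

variable {G G' : SimpleGraph V} {A B Z : Finset V} {u v w z d : V} {n m : ℕ}

lemma left_mem (p : PathIn G A u v n) : u ∈ A := by
  cases p <;> assumption

lemma right_mem (p : PathIn G A u v n) : v ∈ A := by
  induction p with
  | nil hu => exact hu
  | cons hu h p ih => exact Finset.mem_of_mem_erase ih

lemma mono (p : PathIn G A u v n) (h : A ⊆ B) : PathIn G B u v n := by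
  induction p generalizing B with
  | nil hu => exact .nil (h hu)
  | cons hu hadj p ih => exact .cons (h hu) hadj (ih (Finset.erase_subset_erase _ h))

lemma congr (p : PathIn G A u v n)
    (h : ∀ a ∈ A, ∀ b ∈ A, G.Adj a b → G'.Adj a b) : PathIn G' A u v n := by
  induction p with
  | nil hu => exact .nil hu
  | cons hu hadj p ih =>
    refine .cons hu (h _ hu _ (Finset.mem_of_mem_erase p.left_mem) hadj) (ih ?_)
    intro a ha b hb
    exact h a (Finset.mem_of_mem_erase ha) b (Finset.mem_of_mem_erase hb)

lemma join (p : PathIn G A u v n) (q : PathIn G B v w m)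
    (h : ∀ a ∈ A, a ∈ B → a = v) : PathIn G (A ∪ B) u w (n + m) := by
  induction p with
  | nil hu => simpa using q.mono Finset.subset_union_right
  | @cons A u w' v n hu hadj p ih =>
    have huv : u ≠ v := fun e => by have := p.right_mem; simp [e] at this
    have huB : u ∉ B := fun hB => huv (h u hu hB)
    have := ih q (fun a ha hb => h a (Finset.mem_of_mem_erase ha) hb)
    rw [show n + 1 + m = (n + m) + 1 by ring]
    refine .cons (Finset.mem_union_left _ hu) hadj (this.mono ?_)
    intro a ha
    grind

lemma join_subset (p : PathIn G A u v n) (q : PathIn G B v w m)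
    (h : ∀ a ∈ A, a ∈ B → a = v) (hA : A ⊆ Z) (hB : B ⊆ Z) : PathIn G Z u w (n + m) :=
  (p.join q h).mono (Finset.union_subset hA hB)

lemma join_adj (p : PathIn G A u v n) (h : G.Adj v w) (q : PathIn G B w z m)
    (hd : ∀ a ∈ A, a ∉ B) : PathIn G (A ∪ B) u z (n + m + 1) := by
  have hv : v ∉ B := hd v p.right_mem
  have q' : PathIn G (insert v B) v z (m + 1) :=
    .cons (Finset.mem_insert_self _ _) h (q.mono (by grind))
  refine (p.join_subset q' ?_ Finset.subset_union_left ?_)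
  · intro a ha hb
    grind
  · intro a ha
    have := p.right_mem
    grind

lemma adj (h : G.Adj u v) : PathIn G {u, v} u v 1 :=
  .cons (by simp) h (.nil (by have := h.ne; grind))

lemma symm (p : PathIn G A u v n) : PathIn G A v u n := by
  induction p with
  | nil hu => exact .nil hu
  | @cons A u w v n hu hadj p ih =>
    have := ih.join_adj hadj.symm (PathIn.nil (Finset.mem_singleton_self u)) (by grind)
    exact this.mono (by grind)

lemma erase_or (p : PathIn G A w v n) (u : V) :
    PathIn G (A.erase u) w v n ∨ ∃ m, PathIn G A u v m := by
  induction p with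
  | @nil A w hu =>
    by_cases h : w = u
    · exact .inr ⟨0, h ▸ .nil hu⟩
    · exact .inl (.nil (by grind))
  | @cons A w w' v n hu hadj p ih =>
    by_cases h : w = u
    · exact .inr ⟨n + 1, h ▸ .cons hu hadj p⟩
    · rcases ih with ih | ⟨m, ih⟩
      · exact .inl (.cons (by grind) hadj (by rwa [Finset.erase_right_comm]))
      · exact .inr ⟨m, ih.mono (Finset.erase_subset _ _)⟩

/-- A path starting outside a set without outgoing edges avoids this set. -/
lemma confined (p : PathIn G Z u v n) (hu : u ∉ A)
    (h : ∀ a ∈ A, ∀ w ∈ Z, G.Adj a w → w ∈ A) : PathIn G (Z \ A) u v n := by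
  induction p with
  | nil hu' => exact .nil (by grind)
  | @cons Z u w v n hu' hadj p ih =>
    have hw : w ∉ A := fun hw => hu (h w hw u hu' hadj.symm)
    refine .cons (by grind) hadj ((ih hw fun a ha w' hw' => ?_).mono (by grind))
    exact h a ha w' (Finset.mem_of_mem_erase hw')

/-- A path with both ends outside a set which can be left only through `d` avoids this set. -/
lemma avoid_hanging (p : PathIn G Z u v n) (hu : u ∉ A) (hv : v ∉ A)
    (h : ∀ a ∈ A, ∀ w ∈ Z, G.Adj a w → w ∈ A ∨ w = d) : PathIn G (Z \ A) u v n := by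
  induction p with
  | nil hu' => exact .nil (by grind)
  | @cons Z u w v n hu' hadj p ih =>
    by_cases hd : u = d
    · have hc : ∀ a ∈ A, ∀ w ∈ Z.erase u, G.Adj a w → w ∈ A := by
        intro a ha w hw haw
        rcases h a ha w (Finset.mem_of_mem_erase hw) haw with h' | h'
        · exact h'
        · grind
      have hq : PathIn G (Z.erase u \ A) v w n := p.symm.confined hv hc
      exact .cons (by grind) hadj (hq.symm.mono (by grind))
    · have hw : w ∉ A := fun hw => (h w hw u hu' hadj.symm).elim hu hd
      refine .cons (by grind) hadj ((ih hw hv fun a ha w' hw' => ?_).mono (by grind))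
      exact h a ha w' (Finset.mem_of_mem_erase hw')

lemma exists_cons (p : PathIn G A u v n) (h : u ≠ v) :
    ∃ w m, n = m + 1 ∧ G.Adj u w ∧ PathIn G (A.erase u) w v m := by
  cases p with
  | nil => exact absurd rfl h
  | cons hu hadj p => exact ⟨_, _, rfl, hadj, p⟩

lemma exists_walk (p : PathIn G A u v n) :
    ∃ q : G.Walk u v, q.IsPath ∧ q.length = n ∧ ∀ a ∈ q.support, a ∈ A := by
  induction p with
  | nil hu => exact ⟨.nil, by simp, by simp, by simpa using hu⟩
  | cons hu hadj p ih =>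
    obtain ⟨q, hq, hl, hs⟩ := ih
    refine ⟨.cons hadj q, ?_, by simp [hl], ?_⟩
    · rw [SimpleGraph.Walk.cons_isPath_iff]
      exact ⟨hq, fun hmem => by simpa using hs _ hmem⟩
    · intro a ha
      rw [SimpleGraph.Walk.support_cons, List.mem_cons] at ha
      rcases ha with rfl | ha
      · exact hu
      · exact Finset.mem_of_mem_erase (hs a ha)

end PathIn

/-- `u` and `v` are joined by a path of `G` inside `A`. -/
def ReachIn (G : SimpleGraph V) (A : Finset V) (u v : V) : Prop := ∃ n, PathIn G A u v n

namespace ReachIn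

variable {G G' : SimpleGraph V} {A B Z : Finset V} {u v w d : V}

lemma refl (h : u ∈ A) : ReachIn G A u u := ⟨0, .nil h⟩

lemma left_mem (h : ReachIn G A u v) : u ∈ A := h.elim fun _ p => p.left_mem

lemma right_mem (h : ReachIn G A u v) : v ∈ A := h.elim fun _ p => p.right_mem

lemma symm (h : ReachIn G A u v) : ReachIn G A v u := h.elim fun n p => ⟨n, p.symm⟩

lemma mono (h : ReachIn G A u v) (hAB : A ⊆ B) : ReachIn G B u v :=
  h.elim fun n p => ⟨n, p.mono hAB⟩

lemma congr (h : ReachIn G A u v) (hG : ∀ a ∈ A, ∀ b ∈ A, G.Adj a b → G'.Adj a b) :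
    ReachIn G' A u v := h.elim fun n p => ⟨n, p.congr hG⟩

lemma head (hu : u ∈ A) (h : G.Adj u w) (hr : ReachIn G A w v) : ReachIn G A u v := by
  obtain ⟨n, p⟩ := hr
  rcases p.erase_or u with p | h'
  · exact ⟨n + 1, .cons hu h p⟩
  · exact h'

lemma trans (h₁ : ReachIn G A u v) (h₂ : ReachIn G A v w) : ReachIn G A u w := by
  obtain ⟨n, p⟩ := h₁
  have key : ∀ {B : Finset V}, A ⊆ B → ReachIn G B v w → ReachIn G B u w := by
    clear h₂
    induction p with
    | nil => exact fun _ h => h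
    | cons hu hadj p ih =>
      exact fun hB h => head (hB hu) hadj (ih ((Finset.erase_subset _ _).trans hB) h)
  exact key subset_rfl h₂

lemma tail (hr : ReachIn G A u v) (h : G.Adj v w) (hw : w ∈ A) : ReachIn G A u w :=
  hr.trans (head hr.right_mem h (refl hw))

lemma exists_exit (hr : ReachIn G A u v) (hu : u ∈ B) (hv : v ∉ B) :
    ∃ b ∈ B, ∃ w ∈ A, w ∉ B ∧ G.Adj b w ∧ ReachIn G (A ∩ B) u b := by
  obtain ⟨n, p⟩ := hr
  induction p with
  | nil => exact absurd hu hv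
  | @cons A u w v n hu' hadj p ih =>
    by_cases hw : w ∈ B
    · obtain ⟨b, hb, w', hw', hw'B, hbw, hr⟩ := ih hw hv
      exact ⟨b, hb, w', Finset.mem_of_mem_erase hw', hw'B, hbw,
        head (by grind) hadj (hr.mono (by grind))⟩
    · exact ⟨u, hu, w, Finset.mem_of_mem_erase p.left_mem, hw, hadj, refl (by grind)⟩

lemma avoid_hanging (h : ReachIn G Z u v) (hu : u ∉ A) (hv : v ∉ A)
    (hA : ∀ a ∈ A, ∀ w ∈ Z, G.Adj a w → w ∈ A ∨ w = d) : ReachIn G (Z \ A) u v :=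
  h.elim fun n p => ⟨n, p.avoid_hanging hu hv hA⟩

end ReachIn

end PathsInSets

section AdmissibleSets

/-- `L` contains an arithmetic progression of `k` terms with common difference 1 or 2. -/
def IsAdm (L : Set ℕ) (k : ℕ) : Prop :=
  ∃ a d : ℕ, (d = 1 ∨ d = 2) ∧ ∀ i < k, a + i * d ∈ L

lemma IsAdm.add {L₁ L₂ L : Set ℕ} {m m' k : ℕ} (t : ℕ) (h₁ : IsAdm L₁ m) (h₂ : IsAdm L₂ m')
    (hL : ∀ a ∈ L₁, ∀ b ∈ L₂, a + b + t ∈ L) (hm : 1 ≤ m) (hm' : 1 ≤ m')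
    (hk : k ≤ m + m' - 1) : IsAdm L k := by
  have mixed : ∀ {L₁ L₂ : Set ℕ} {m m' : ℕ} {a b : ℕ}, (∀ i < m, a + i * 1 ∈ L₁) →
      (∀ i < m', b + i * 2 ∈ L₂) → (∀ a ∈ L₁, ∀ b ∈ L₂, a + b + t ∈ L) → 1 ≤ m → 1 ≤ m' →
      k ≤ m + m' - 1 → IsAdm L k := by
    intro L₁ L₂ m m' a b h₁ h₂ hL hm hm' hk
    rcases Nat.lt_or_ge 1 m with h | h
    · refine ⟨a + b + t, 1, .inl rfl, fun i hi => ?_⟩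
      by_cases hi' : i / 2 < m'
      · have := hL _ (h₁ (i % 2) (by omega)) _ (h₂ (i / 2) hi')
        convert this using 1
        omega
      · have := hL _ (h₁ (i - 2 * (m' - 1)) (by omega)) _ (h₂ (m' - 1) (by omega))
        convert this using 1
        omega
    · refine ⟨a + b + t, 2, .inr rfl, fun i hi => ?_⟩
      have := hL _ (h₁ 0 (by omega)) _ (h₂ i (by omega))
      convert this using 1
      omega
  have same : ∀ {a b d : ℕ}, (d = 1 ∨ d = 2) → (∀ i < m, a + i * d ∈ L₁) →
      (∀ i < m', b + i * d ∈ L₂) → IsAdm L k := by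
    intro a b d hd h₁ h₂
    refine ⟨a + b + t, d, hd, fun i hi => ?_⟩
    have := hL _ (h₁ (min i (m - 1)) (by omega)) _ (h₂ (i - min i (m - 1)) (by omega))
    convert this using 1
    have hs : i = min i (m - 1) + (i - min i (m - 1)) := by omega
    generalize min i (m - 1) = p at *
    generalize i - p = q at *
    subst hs
    ring
  obtain ⟨a, d, hd, h₁⟩ := h₁
  obtain ⟨b, d', hd', h₂⟩ := h₂
  rcases hd with rfl | rfl <;> rcases hd' with rfl | rfl
  · exact same (.inl rfl) h₁ h₂
  · exact mixed h₁ h₂ hL hm hm' hk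
  · exact mixed h₂ h₁ (fun a ha b hb => by rw [add_comm a b]; exact hL b hb a ha) hm' hm
      (by omega)
  · exact same (.inr rfl) h₁ h₂

end AdmissibleSets

section RootedGraphs

variable {V : Type*} [DecidableEq V]

open Classical in
/-- The neighbours of `v` inside `W`. -/
noncomputable def nbr (G : SimpleGraph V) (W : Finset V) (v : V) : Finset V :=
  {u ∈ W | G.Adj v u}

/-- There are `k` paths from `x` to `y` inside `W` with admissible lengths. -/
def Adm (G : SimpleGraph V) (W : Finset V) (x y : V) (k : ℕ) : Prop :=
  IsAdm {n | PathIn G W x y n} k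

/-- Adding the edge `xy` to the subgraph induced on `W` makes it 2-connected. -/
def Rooted (G : SimpleGraph V) (W : Finset V) (x y : V) : Prop :=
  x ∈ W ∧ y ∈ W ∧ x ≠ y ∧ ∀ c, ∀ v ∈ W, v ≠ x → v ≠ y → v ≠ c →
    ReachIn G ((W.erase c).erase y) v x ∨ ReachIn G ((W.erase c).erase x) v y

open Classical in
/-- The vertices of `W` separated from both `x` and `y` by `c`. -/
noncomputable def bad (G : SimpleGraph V) (W : Finset V) (x y c : V) : Finset V :=
  {v ∈ W | v ≠ x ∧ v ≠ y ∧ v ≠ c ∧ ¬ (ReachIn G ((W.erase c).erase y) v x ∨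
    ReachIn G ((W.erase c).erase x) v y)}

/-- The graph in which the neighbours of `x` are replaced by the neighbours of `E`. -/
def contr (G : SimpleGraph V) (x : V) (E : Finset V) : SimpleGraph V where
  Adj u v := (u ≠ x ∧ v ≠ x ∧ G.Adj u v) ∨ (u = x ∧ v ≠ x ∧ ∃ e ∈ E, G.Adj e v) ∨
    (v = x ∧ u ≠ x ∧ ∃ e ∈ E, G.Adj e u)
  symm := ⟨by
    rintro u v (⟨h₁, h₂, h⟩ | h | h)
    · exact .inl ⟨h₂, h₁, h.symm⟩
    · exact .inr (.inr h)
    · exact .inr (.inl h)⟩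
  loopless := ⟨by
    rintro u (⟨h₁, h₂, h⟩ | ⟨h₁, h₂, h⟩ | ⟨h₁, h₂, h⟩)
    · exact h.ne rfl
    · exact h₂ h₁
    · exact h₂ h₁⟩

variable {G G' : SimpleGraph V} {W A B Z E H P : Finset V} {u v w x y z c d p q : V}
  {k l m n : ℕ}

@[simp] lemma mem_nbr : u ∈ nbr G W v ↔ u ∈ W ∧ G.Adj v u := by
  simp [nbr]

lemma nbr_card_le (h : ∀ u ∈ W, G.Adj v u → u ∈ B ∧ G'.Adj v u) :
    (nbr G W v).card ≤ (nbr G' B v).card := by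
  refine Finset.card_le_card fun u hu => ?_
  rw [mem_nbr] at hu ⊢
  exact h u hu.1 hu.2

lemma nbr_card_le_add (h : ∀ u ∈ W, G.Adj v u → u ∈ A ∨ u ∈ B) :
    (nbr G W v).card ≤ (nbr G A v).card + B.card := by
  refine (Finset.card_le_card fun u hu => ?_).trans (Finset.card_union_le _ _)
  rw [mem_nbr] at hu
  rw [Finset.mem_union, mem_nbr]
  rcases h u hu.1 hu.2 with h | h
  · exact .inl ⟨h, hu.2⟩
  · exact .inr h

namespace Adm

lemma mono (h : Adm G A x y k) (hAB : A ⊆ B) : Adm G B x y k := by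
  obtain ⟨a, d, hd, h⟩ := h
  exact ⟨a, d, hd, fun i hi => (h i hi).mono hAB⟩

lemma le (h : Adm G A x y k) (hl : l ≤ k) : Adm G A x y l := by
  obtain ⟨a, d, hd, h⟩ := h
  exact ⟨a, d, hd, fun i hi => h i (by omega)⟩

lemma symm (h : Adm G A x y k) : Adm G A y x k := by
  obtain ⟨a, d, hd, h⟩ := h
  exact ⟨a, d, hd, fun i hi => (h i hi).symm⟩

lemma congr (h : Adm G A x y k) (hG : ∀ a ∈ A, ∀ b ∈ A, G.Adj a b → G'.Adj a b) :
    Adm G' A x y k := by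
  obtain ⟨a, d, hd, h⟩ := h
  exact ⟨a, d, hd, fun i hi => (h i hi).congr hG⟩

lemma join (h₁ : Adm G A x v m) (h₂ : Adm G B v y n) (h : ∀ a ∈ A, a ∈ B → a = v)
    (hA : A ⊆ Z) (hB : B ⊆ Z) (hm : 1 ≤ m) (hn : 1 ≤ n) (hk : k ≤ m + n - 1) :
    Adm G Z x y k :=
  IsAdm.add 0 h₁ h₂ (fun a ha b hb => PathIn.join_subset (n := a) (m := b) ha hb h hA hB)
    hm hn hk

lemma zero : Adm G A x y 0 := ⟨0, 1, .inl rfl, by omega⟩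

end Adm

lemma ReachIn.adm (h : ReachIn G A x y) : Adm G A x y 1 := by
  obtain ⟨n, p⟩ := h
  exact ⟨n, 1, .inl rfl, fun i hi => by simpa [show i = 0 by omega] using p⟩

lemma Adm.then_reach (h₁ : Adm G A x v k) (h₂ : ReachIn G B v y) (h : ∀ a ∈ A, a ∈ B → a = v)
    (hA : A ⊆ Z) (hB : B ⊆ Z) : Adm G Z x y k := by
  rcases k.eq_zero_or_pos with rfl | hk
  · exact Adm.zero
  · exact h₁.join h₂.adm h hA hB hk le_rfl (by omega)

lemma ReachIn.then_adm (h₂ : ReachIn G B x v) (h₁ : Adm G A v y k)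
    (h : ∀ a ∈ A, a ∈ B → a = v) (hA : A ⊆ Z) (hB : B ⊆ Z) : Adm G Z x y k :=
  (h₁.symm.then_reach h₂.symm h hA hB).symm

lemma mem_bad : v ∈ bad G W x y c ↔ v ∈ W ∧ v ≠ x ∧ v ≠ y ∧ v ≠ c ∧
    ¬ (ReachIn G ((W.erase c).erase y) v x ∨ ReachIn G ((W.erase c).erase x) v y) := by
  simp [bad]

lemma bad_closed (hxy : x ≠ y) (hv : v ∈ bad G W x y c) (hw : w ∈ W) (h : G.Adj v w) :
    w ∈ bad G W x y c ∨ w = c := by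
  by_contra hcon
  push Not at hcon
  rw [mem_bad] at hv
  obtain ⟨hvW, hvx, hvy, hvc, hr⟩ := hv
  obtain ⟨hb, hwc⟩ := hcon
  refine hr ?_
  by_cases hwx : w = x
  · exact .inl (.head (by grind) h (hwx ▸ .refl (by grind)))
  by_cases hwy : w = y
  · exact .inr (.head (by grind) h (hwy ▸ .refl (by grind)))
  rw [mem_bad] at hb
  by_contra hr'
  refine hb ⟨hw, hwx, hwy, hwc, ?_⟩
  rintro (h1 | h1)
  · exact hr' (.inl (.head (by grind) h h1))
  · exact hr' (.inr (.head (by grind) h h1))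

namespace Rooted

lemma symm (h : Rooted G W x y) : Rooted G W y x :=
  ⟨h.2.1, h.1, h.2.2.1.symm, fun c v hv hx hy hc => (h.2.2.2 c v hv hy hx hc).symm⟩

lemma of_bad (hx : x ∈ W) (hy : y ∈ W) (hxy : x ≠ y) (h : ∀ c, bad G W x y c = ∅) :
    Rooted G W x y := by
  refine ⟨hx, hy, hxy, fun c v hv hvx hvy hvc => ?_⟩
  by_contra hcon
  have := Finset.notMem_empty v
  rw [← h c, mem_bad] at this
  exact this ⟨hv, hvx, hvy, hvc, hcon⟩

lemma exit (h : Rooted G W x y) (hA : A ⊆ W) (hx : x ∉ A) (hy : y ∉ A) (hv : v ∈ A)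
    (hvd : v ≠ d) : ∃ b ∈ A, ∃ w ∈ W, w ∉ A ∧ w ≠ d ∧ G.Adj b w ∧ ReachIn G (A.erase d) v b := by
  rcases h.2.2.2 d v (hA hv) (by grind) (by grind) hvd with hr | hr
  · obtain ⟨b, hb, w, hw, hwA, hbw, hr⟩ := hr.exists_exit hv hx
    exact ⟨b, hb, w, by grind, hwA, by grind, hbw, hr.mono (by grind)⟩
  · obtain ⟨b, hb, w, hw, hwA, hbw, hr⟩ := hr.exists_exit hv hy
    exact ⟨b, hb, w, by grind, hwA, by grind, hbw, hr.mono (by grind)⟩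

lemma reach_right (h : Rooted G W x y) (hv : v ∈ W) (hvx : v ≠ x) :
    ReachIn G (W.erase x) v y := by
  by_cases hvy : v = y
  · subst hvy
    exact .refl (by grind)
  rcases h.2.2.2 x v hv hvx hvy hvx with hr | hr
  · have := hr.right_mem
    grind
  · exact hr.mono (by grind)

lemma reach_left (h : Rooted G W x y) (hv : v ∈ W) (hvy : v ≠ y) :
    ReachIn G (W.erase y) v x :=
  h.symm.reach_right hv hvy

lemma reach (h : Rooted G W x y) (hv : v ∈ W) (hvx : v ≠ x) (hvy : v ≠ y) :
    ReachIn G W x y :=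
  ((h.reach_left hv hvy).mono (Finset.erase_subset _ _)).symm.trans
    ((h.reach_right hv hvx).mono (Finset.erase_subset _ _))

lemma sub (h : Rooted G W x y) (hA : A ⊆ W) (hx : x ∉ A) (hy : y ∉ A) (hp : p ∉ A)
    (hq : q ∉ A) (hpq : p ≠ q) (hN : ∀ a ∈ A, ∀ w ∈ W, G.Adj a w → w ∈ A ∨ w = p ∨ w = q) :
    Rooted G (A ∪ {p, q}) p q := by
  refine ⟨by simp, by simp, hpq, fun c v hv hvp hvq hvc => ?_⟩
  have hvA : v ∈ A := by simpa [hvp, hvq] using hv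
  obtain ⟨b, hb, w, hw, hwA, hwc, hbw, hr⟩ := h.exit hA hx hy hvA hvc
  rcases hN b hb w hw hbw with h | rfl | rfl
  · exact absurd h hwA
  · exact .inl ((hr.mono (by grind)).tail hbw (by grind))
  · exact .inr ((hr.mono (by grind)).tail hbw (by grind))

lemma congr (h : Rooted G W x y)
    (hG : ∀ a b, ¬ (a = x ∧ b = y) → ¬ (a = y ∧ b = x) → G.Adj a b → G'.Adj a b) :
    Rooted G' W x y := by
  refine ⟨h.1, h.2.1, h.2.2.1, fun c v hv hx hy hc => ?_⟩
  rcases h.2.2.2 c v hv hx hy hc with hr | hr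
  · exact .inl (hr.congr fun a ha b hb hab => hG a b (by grind) (by grind) hab)
  · exact .inr (hr.congr fun a ha b hb hab => hG a b (by grind) (by grind) hab)

end Rooted

lemma exists_deleteEdge (G : SimpleGraph V) (x y : V) : ∃ G' : SimpleGraph V, G' ≤ G ∧
    ¬ G'.Adj x y ∧
    ∀ a b, ¬ (a = x ∧ b = y) → ¬ (a = y ∧ b = x) → G.Adj a b → G'.Adj a b := by
  refine ⟨G.deleteEdges {s(x, y)}, SimpleGraph.deleteEdges_le _, by simp, ?_⟩
  intro a b h₁ h₂ h
  rw [SimpleGraph.deleteEdges_adj]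
  refine ⟨h, ?_⟩
  simp only [Set.mem_singleton_iff, Sym2.eq_iff]
  tauto

lemma contr_adj_of_ne (hu : u ≠ x) (hv : v ≠ x) : (contr G x E).Adj u v ↔ G.Adj u v := by
  simp [contr, hu, hv]

lemma contr_adj_left (hv : v ≠ x) : (contr G x E).Adj x v ↔ ∃ e ∈ E, G.Adj e v := by
  simp [contr, hv]

lemma contr_reach (h : ReachIn G A u v) (hx : x ∉ A) : ReachIn (contr G x E) A u v :=
  h.congr fun a ha b hb hab => (contr_adj_of_ne (by grind) (by grind)).2 hab

lemma contr_rooted (hxP : x ∉ P) (hcP : c ∉ P) (hcx : c ≠ x)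
    (h₁ : ∀ v ∈ P, ReachIn G (insert c P) v c)
    (h₂ : ∀ v ∈ P, ∃ u ∈ P, (∃ e ∈ E, G.Adj e u) ∧ ReachIn G P v u)
    (h₃ : ∀ d ∈ P, ∀ v ∈ P, v ≠ d → ReachIn G ((insert c P).erase d) v c ∨
      ∃ u ∈ P, (∃ e ∈ E, G.Adj e u) ∧ ReachIn G (P.erase d) v u) :
    Rooted (contr G x E) (P ∪ {x, c}) x c := by
  refine ⟨by simp, by simp, hcx.symm, fun d v hv hvx hvc hvd => ?_⟩
  have hvP : v ∈ P := by simpa [hvx, hvc] using hv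
  by_cases hdP : d ∈ P
  · rcases h₃ d hdP v hvP hvd with h | ⟨u, hu, ⟨e, he, heu⟩, hr⟩
    · exact .inr ((contr_reach h (by grind)).mono (by grind))
    · refine .inl (((contr_reach hr (by grind)).mono (by grind)).tail (v := u) ?_ (by grind))
      exact ((contr_adj_left (by grind)).2 ⟨e, he, heu⟩).symm
  by_cases hdc : d = c
  · obtain ⟨u, hu, ⟨e, he, heu⟩, hr⟩ := h₂ v hvP
    refine .inl (((contr_reach hr (by grind)).mono (by grind)).tail (v := u) ?_ (by grind))
    exact ((contr_adj_left (by grind)).2 ⟨e, he, heu⟩).symm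
  · exact .inr ((contr_reach (h₁ v hvP) (by grind)).mono (by grind))

lemma contr_nbr (hxP : x ∉ P) (hcx : c ≠ x) (hu : u ∈ P)
    (hN : ∀ w ∈ W, G.Adj u w → w ∈ P ∨ w ∈ H ∨ w = c)
    (hl : (nbr G H u).card ≤ l ∨ (∃ e ∈ E, G.Adj e u) ∧ (nbr G H u).card ≤ l + 1) :
    (nbr G W u).card ≤ (nbr (contr G x E) (P ∪ {x, c}) u).card + l := by
  have hsub : nbr G W u ⊆ nbr G (insert c P) u ∪ nbr G H u := by
    intro w hw
    rw [mem_nbr] at hw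
    rcases hN w hw.1 hw.2 with h | h | h <;> simp [h, hw.2]
    exact .inl (h ▸ hw.2)
  have h1 := (Finset.card_le_card hsub).trans (Finset.card_union_le _ _)
  have h2 : nbr G (insert c P) u ⊆ nbr (contr G x E) (P ∪ {x, c}) u := by
    intro w hw
    rw [mem_nbr] at hw ⊢
    exact ⟨by grind, (contr_adj_of_ne (by grind) (by grind)).2 hw.2⟩
  rcases hl with hl | ⟨⟨e, he, heu⟩, hl⟩
  · have := Finset.card_le_card h2
    omega
  · have h3 : insert x (nbr G (insert c P) u) ⊆ nbr (contr G x E) (P ∪ {x, c}) u := by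
      refine Finset.insert_subset ?_ h2
      rw [mem_nbr]
      exact ⟨by simp, ((contr_adj_left (by grind)).2 ⟨e, he, heu⟩).symm⟩
    have := Finset.card_le_card h3
    rw [Finset.card_insert_of_notMem (by grind [mem_nbr])] at this
    omega

lemma contr_lift (hcx : c ≠ x) (hPH : ∀ v ∈ P, v ∉ H) (hcH : c ∉ H)
    (hcore : ∃ a d : ℕ, (d = 1 ∨ d = 2) ∧ ∀ e ∈ E, ∀ i < l, PathIn G H x e (a + i * d))
    (hA : Adm (contr G x E) (P ∪ {x, c}) x c m) (hm : 1 ≤ m) (hl : 1 ≤ l)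
    (hk : k ≤ m + l - 1) : Adm G (H ∪ insert c P) x c k := by
  obtain ⟨a, d, hd, hcore⟩ := hcore
  have h2 : IsAdm {n | ∀ e ∈ E, PathIn G H x e n} l := ⟨a, d, hd, fun i hi e he => hcore e he i hi⟩
  refine IsAdm.add 0 hA h2 ?_ hm hl hk
  intro n hn s hs
  obtain ⟨u, r, rfl, hxu, hp⟩ := PathIn.exists_cons hn hcx.symm
  have hu := hp.left_mem
  obtain ⟨e, he, heu⟩ := (contr_adj_left (by grind)).1 hxu
  have hp' : PathIn G (insert c P) u c r :=
    ((hp.congr (G' := G) fun a ha b hb hab =>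
      (contr_adj_of_ne (by grind) (by grind)).1 hab)).mono (by grind)
  have := (hs e he).join_adj heu hp' (by grind)
  change PathIn G _ x c _
  convert this using 1
  ring

end RootedGraphs

section TwoPaths

variable {V : Type*} [DecidableEq V]

open Classical in
/-- The vertices of `Z` joined to `r` inside `Z`. -/
noncomputable def comp (G : SimpleGraph V) (Z : Finset V) (r : V) : Finset V :=
  {v ∈ Z | ReachIn G Z v r}

variable {G G' : SimpleGraph V} {W A B Z E H P S : Finset V} {r s t u v w x y z c d p q : V}
  {k l m n N : ℕ}

lemma mem_comp : v ∈ comp G Z r ↔ v ∈ Z ∧ ReachIn G Z v r := by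
  simp [comp]

lemma comp_subset : comp G Z r ⊆ Z := fun _ hv => (mem_comp.1 hv).1

lemma self_mem_comp (h : r ∈ Z) : r ∈ comp G Z r := mem_comp.2 ⟨h, .refl h⟩

lemma comp_closed (hv : v ∈ comp G Z r) (hw : w ∈ Z) (h : G.Adj v w) : w ∈ comp G Z r := by
  rw [mem_comp] at hv ⊢
  exact ⟨hw, .head hw h.symm hv.2⟩

lemma comp_closed' (hv : v ∈ comp G Z r) (hw : w ∈ Z) (h : G.Adj w v) : w ∈ comp G Z r :=
  comp_closed hv hw h.symm

lemma ReachIn.in_comp (h : ReachIn G Z v r) : ReachIn G (comp G Z r) v r := by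
  obtain ⟨n, p⟩ := h
  have key : ∀ {B : Finset V}, Z ⊆ B → ReachIn G (comp G B r) v r := by
    induction p with
    | nil hu => exact fun hB => .refl (self_mem_comp (hB hu))
    | cons hu hadj p ih =>
      intro B hB
      have := ih ((Finset.erase_subset _ _).trans hB)
      exact .head (comp_closed' this.left_mem (hB hu) hadj) hadj this
  exact key subset_rfl

lemma comp_reach (h : v ∈ comp G Z r) : ReachIn G (comp G Z r) v r :=
  (mem_comp.1 h).2.in_comp

lemma exists_nbr_notMem (h : S.card < (nbr G W v).card) : ∃ w ∈ W, G.Adj v w ∧ w ∉ S := by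
  obtain ⟨w, hw, hwS⟩ := Finset.exists_mem_notMem_of_card_lt_card h
  rw [mem_nbr] at hw
  exact ⟨w, hw.1, hw.2, hwS⟩

lemma ReachIn.exists_adj (h : ReachIn G A u v) (huv : u ≠ v) : ∃ w ∈ A, w ≠ u ∧ G.Adj u w := by
  obtain ⟨n, p⟩ := h
  obtain ⟨w, m, -, hadj, hp⟩ := p.exists_cons huv
  exact ⟨w, Finset.mem_of_mem_erase hp.left_mem, hadj.ne', hadj⟩

lemma Rooted.extend (h : Rooted G W x y) (hA : A ⊆ W) (hy : y ∉ A) (hq : q ∈ W)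
    (hqA : q ∉ A) (hqx : q ≠ x)
    (hN : ∀ a ∈ A, ∀ w ∈ W, G.Adj a w → w ∈ A ∨ w = x ∨ w = q)
    (hadm : Adm G (A ∪ {x, q}) x q k) : Adm G W x y k := by
  have h1 := (h.reach_right hq hqx).avoid_hanging (A := A) (d := q) hqA hy (by
    intro a ha w hw haw
    rcases hN a ha w (by grind) haw with h | h | h
    · exact .inl h
    · grind
    · exact .inr h)
  refine hadm.then_reach h1 (by grind) ?_ (by grind)
  intro a ha
  have := h.1
  grind

/-- The statement, for sets with fewer than `N` vertices, that a rooted graph all whose vertices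
except the roots and `z` have degree at least three has two admissible paths. -/
def TwoPathsBelow (V : Type*) [DecidableEq V] (N : ℕ) : Prop :=
  ∀ (G : SimpleGraph V) (W : Finset V) (x y z : V), W.card < N → Rooted G W x y →
    (∃ v ∈ W, v ≠ x ∧ v ≠ y ∧ v ≠ z) →
    (∀ v ∈ W, v ≠ x → v ≠ y → v ≠ z → 3 ≤ (nbr G W v).card) → Adm G W x y 2

lemma card_lt_of_mem (hA : A ⊆ W) (hw : w ∈ W) (hwA : w ∉ A) : A.card < W.card :=
  Finset.card_lt_card ⟨hA, fun h => hwA (h hw)⟩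

lemma two_of_triangle {a b : V} (h : Rooted G W x y) (ha : a ∈ W) (hb : b ∈ W) (hya : a ≠ y)
    (hyb : b ≠ y) (hxa : G.Adj x a) (hxb : G.Adj x b) (hab : G.Adj a b) : Adm G W x y 2 := by
  have hr := (h.reach_right ha hxa.ne').symm
  obtain ⟨c, hc, w, hw, hwB, hcw, hcr⟩ := hr.exists_exit (B := (W.erase x) \ {a, b})
    (by have := h.2.1; have := h.2.2.1; grind) (by grind)
  have key : ∀ a b : V, a ∈ W → b ∈ W → G.Adj x a → G.Adj x b → G.Adj a b →
      c ∈ (W.erase x) \ {a, b} → ReachIn G (W.erase x ∩ ((W.erase x) \ {a, b})) y c →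
      G.Adj c a → Adm G W x y 2 := by
    intro a b ha hb hxa hxb hab hc hr hca
    have h1 : Adm G {x, a, b} x a 2 := by
      refine ⟨1, 1, .inl rfl, fun i hi => ?_⟩
      have := hxa.ne
      have := hxb.ne
      have := hab.ne
      interval_cases i
      · exact (PathIn.adj hxa).mono (by grind)
      · exact .cons (by simp) hxb ((PathIn.adj hab.symm).mono (by grind))
    have h2 : ReachIn G (insert a ((W.erase x) \ {a, b})) a y :=
      .head (by simp) hca.symm (hr.symm.mono (by grind))
    have hxW := h.1
    exact h1.then_reach h2 (by grind) (by grind) (by grind)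
  have hw' : w = a ∨ w = b := by grind
  rcases hw' with rfl | rfl
  · exact key w b ha hb hxa hxb hab hc hcr hcw
  · exact key w a hb ha hxb hxa hab.symm (by grind) (by rwa [Finset.pair_comm]) hcw

lemma two_of_square {a b : V} (h : Rooted G W x y) (ha : a ∈ W) (hb : b ∈ W) (hs : s ∈ W)
    (hya : a ≠ y) (hyb : b ≠ y) (hys : s ≠ y) (hxs : s ≠ x) (hab : a ≠ b)
    (hxa : G.Adj x a) (hxb : G.Adj x b) (hsa : G.Adj s a) (hsb : G.Adj s b)
    (hr : ReachIn G ((W.erase x).erase s) a y) : Adm G W x y 2 := by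
  obtain ⟨c, hc, w, hw, hwB, hcw, hcr⟩ := hr.symm.exists_exit (B := ((W.erase x).erase s) \ {a, b})
    (by have := h.2.1; have := h.2.2.1; grind) (by grind)
  have key : ∀ a b : V, a ∈ W → b ∈ W → a ≠ b → G.Adj x a → G.Adj x b → G.Adj s a → G.Adj s b →
      c ∈ ((W.erase x).erase s) \ {a, b} →
      ReachIn G ((W.erase x).erase s ∩ (((W.erase x).erase s) \ {a, b})) y c →
      G.Adj c a → Adm G W x y 2 := by
    intro a b ha hb hab hxa hxb hsa hsb hc hr hca
    have h1 : Adm G {x, a, b, s} x a 2 := by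
      refine ⟨1, 2, .inr rfl, fun i hi => ?_⟩
      have := hxa.ne
      have := hxb.ne
      have := hsa.ne
      have := hsb.ne
      interval_cases i
      · exact (PathIn.adj hxa).mono (by grind)
      · exact .cons (by simp) hxb (.cons (w := s) (by grind) hsb.symm
          ((PathIn.adj hsa).mono (by grind)))
    have h2 : ReachIn G (insert a (((W.erase x).erase s) \ {a, b})) a y :=
      .head (by simp) hca.symm (hr.symm.mono (by grind))
    have hxW := h.1
    exact h1.then_reach h2 (by grind) (by grind) (by grind)
  have hw' : w = a ∨ w = b := by grind
  rcases hw' with rfl | rfl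
  · exact key w b ha hb hab hxa hxb hsa hsb hc hcr hcw
  · exact key w a hb ha hab.symm hxb hxa hsb hsa (by grind) (by rwa [Finset.pair_comm]) hcw

namespace TwoPathsBelow

variable (IH : TwoPathsBelow V W.card) (h : Rooted G W x y)
  (hdeg : ∀ v ∈ W, v ≠ x → v ≠ y → v ≠ z → 3 ≤ (nbr G W v).card)

include IH h hdeg

lemma of_sub (hA : A ⊆ W) (hx : x ∉ A) (hy : y ∉ A) (hq : q ∈ W) (hqA : q ∉ A) (hqx : q ≠ x)
    (hN : ∀ a ∈ A, ∀ w ∈ W, G.Adj a w → w ∈ A ∨ w = x ∨ w = q) (hv : v ∈ A) (hvz : v ≠ z)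
    (hw : w ∈ W) (hwA : w ∉ A) (hwx : w ≠ x) (hwq : w ≠ q) : Adm G W x y 2 := by
  refine h.extend hA hy hq hqA hqx hN (IH G _ x q z ?_
    (h.sub hA hx hy hx hqA hqx.symm hN) ⟨v, by grind⟩ ?_)
  · refine card_lt_of_mem ?_ hw (by grind)
    have := h.1
    grind
  · intro u hu hux huq huz
    have huA : u ∈ A := by grind
    refine (hdeg u (hA huA) (by grind) (by grind) huz).trans (nbr_card_le fun w hw huw => ⟨?_, huw⟩)
    have := hN u huA w hw huw
    grind

lemma no_square {a b : V} (hno : ¬ Adm G W x y 2) (ha : a ∈ W) (hb : b ∈ W) (hs : s ∈ W)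
    (hya : a ≠ y) (hyb : b ≠ y) (hys : s ≠ y) (hxs : s ≠ x) (hab : a ≠ b)
    (hxa : G.Adj x a) (hxb : G.Adj x b) (hsa : G.Adj s a) (hsb : G.Adj s b) : False := by
  have key : ∀ a b : V, a ∈ W → b ∈ W → a ≠ b → a ≠ y → b ≠ y → G.Adj x a → G.Adj x b →
      G.Adj s a → G.Adj s b → a ≠ z → False := by
    intro a b ha hb hab hya hyb hxa hxb hsa hsb haz
    by_cases hr : ReachIn G ((W.erase x).erase s) a y
    · exact hno (two_of_square h ha hb hs hya hyb hys hxs hab hxa hxb hsa hsb hr)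
    refine hno (IH.of_sub h hdeg (A := comp G ((W.erase x).erase s) a) (q := s) (v := a) (w := y)
      ?_ ?_ ?_ hs ?_ hxs ?_ ?_ haz h.2.1 ?_ h.2.2.1.symm hys.symm)
    · intro v hv
      have := comp_subset hv
      grind
    · intro hv
      have := comp_subset hv
      grind
    · intro hv
      exact hr (mem_comp.1 hv).2.symm
    · intro hv
      have := comp_subset hv
      grind
    · intro v hv w hw hvw
      by_cases h1 : w = x
      · exact .inr (.inl h1)
      by_cases h2 : w = s
      · exact .inr (.inr h2)
      exact .inl (comp_closed hv (by grind) hvw)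
    · have := hxa.ne
      have := hsa.ne
      exact self_mem_comp (by grind)
    · intro hv
      exact hr (mem_comp.1 hv).2.symm
  by_cases haz : a = z
  · exact key b a hb ha hab.symm hyb hya hxb hxa hsb hsa (by grind)
  · exact key a b ha hb hab hya hyb hxa hxb hsa hsb haz

lemma nbr_le_one (hno : ¬ Adm G W x y 2) (hxy : ¬ G.Adj x y) (hu : u ∈ W) (hux : u ≠ x)
    (huy : u ≠ y) (hxu : ¬ G.Adj x u) (hxE : ∀ e ∈ E, e ∈ W ∧ G.Adj x e)  :
    (nbr G (insert x E) u).card ≤ 1 := by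
  rw [Finset.card_le_one]
  intro a ha b hb
  rw [mem_nbr, Finset.mem_insert] at ha hb
  obtain ⟨rfl | ha, hua⟩ := ha
  · exact absurd hua.symm hxu
  obtain ⟨rfl | hb, hub⟩ := hb
  · exact absurd hub.symm hxu
  obtain ⟨haW, hxa⟩ := hxE a ha
  obtain ⟨hbW, hxb⟩ := hxE b hb
  by_contra hab
  exact IH.no_square h hdeg hno haW hbW hu (by grind) (by grind) huy hux hab hxa hxb hua hub

/-- Contracting `x` with a set `E` of its neighbours. -/
lemma of_contr (hno : ¬ Adm G W x y 2) (hxy : ¬ G.Adj x y) (hPW : P ⊆ W) (hcW : c ∈ W)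
    (hPx : ∀ v ∈ P, v ≠ x ∧ v ≠ y ∧ ¬ G.Adj x v ∧ v ≠ c) (hcx : c ≠ x)
    (hEx : ∀ e ∈ E, e ∈ W ∧ G.Adj x e ∧ e ≠ c)
    (hN : ∀ a ∈ P, ∀ w ∈ W, G.Adj a w → w ∈ P ∨ w ∈ E ∨ w = c)
    (h₁ : ∀ v ∈ P, ReachIn G (insert c P) v c) (hw : w ∈ W) (hwP : w ∉ P) (hwx : w ≠ x)
    (hwc : w ≠ c) (hr : r ∈ P) (hrz : r ≠ z) :
    Adm G (insert x E ∪ insert c P) x c 2 := by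
  have hexit : ∀ d, ∀ v ∈ P, v ≠ d → (ReachIn G ((insert c P).erase d) v c ∧ d ≠ c) ∨
      ∃ u ∈ P, (∃ e ∈ E, G.Adj e u) ∧ ReachIn G (P.erase d) v u := by
    intro d v hv hvd
    obtain ⟨b, hb, w, hw, hwP, hwd, hbw, hr⟩ := h.exit hPW (by grind) (by grind) hv hvd
    rcases hN b hb w hw hbw with h | h | rfl
    · exact absurd h hwP
    · exact .inr ⟨b, hb, ⟨w, h, hbw.symm⟩, hr⟩
    · exact .inl ⟨(hr.mono (by grind)).tail hbw (by grind), hwd.symm⟩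
  have hroot : Rooted (contr G x E) (P ∪ {x, c}) x c := by
    refine contr_rooted (by grind) (by grind) hcx h₁ ?_ ?_
    · intro v hv
      rcases hexit c v hv (by grind) with ⟨-, h⟩ | ⟨u, hu, he, hr⟩
      · exact absurd rfl h
      · exact ⟨u, hu, he, hr.mono (by grind)⟩
    · intro d hd v hv hvd
      exact (hexit d v hv hvd).imp_left And.left
  have hadm : Adm (contr G x E) (P ∪ {x, c}) x c 2 := by
    refine IH _ _ x c z (card_lt_of_mem ?_ hw (by grind)) hroot ⟨r, by grind⟩ ?_
    · have := h.1
      grind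
    · intro u hu hux huc huz
      have huP : u ∈ P := by grind
      have h3 := hdeg u (hPW huP) hux (hPx u huP).2.1 huz
      refine h3.trans (contr_nbr (l := 0) (H := insert x E) (by grind) hcx huP ?_ ?_)
      · intro w hw huw
        have := hN u huP w hw huw
        grind
      · have h1 : (nbr G (insert x E) u).card ≤ 1 :=
          IH.nbr_le_one h hdeg hno hxy (hPW huP) hux (hPx u huP).2.1 (hPx u huP).2.2.1
            (fun e he => ⟨(hEx e he).1, (hEx e he).2.1⟩)
        rcases Nat.eq_zero_or_pos (nbr G (insert x E) u).card with h0 | h0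
        · exact .inl h0.le
        · refine .inr ⟨?_, h1⟩
          obtain ⟨e, he⟩ := Finset.card_pos.1 h0
          rw [mem_nbr, Finset.mem_insert] at he
          obtain ⟨rfl | he, hue⟩ := he
          · exact absurd hue.symm (hPx u huP).2.2.1
          · exact ⟨e, he, hue.symm⟩
  refine contr_lift (l := 1) (m := 2) hcx ?_ (by grind) ⟨1, 1, .inl rfl, ?_⟩ hadm (by omega)
    le_rfl (by omega)
  · intro v hv
    have := hPx v hv
    grind
  · intro e he i hi
    rw [show 1 + i * 1 = 1 by omega]
    exact (PathIn.adj (hEx e he).2.1).mono (by grind)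

end TwoPathsBelow

end TwoPaths

section TwoPaths2

variable {V : Type*} [DecidableEq V]
variable {G G' : SimpleGraph V} {W A B Z E H P S : Finset V} {r s t u v w x y z c d p q : V}
  {k l m n N : ℕ}

namespace TwoPathsBelow

variable (IH : TwoPathsBelow V W.card) (h : Rooted G W x y)
  (hdeg : ∀ v ∈ W, v ≠ x → v ≠ y → v ≠ z → 3 ≤ (nbr G W v).card)

include IH h hdeg

lemma of_pendant (hxy : ¬ G.Adj x y) (hno : ¬ Adm G W x y 2) (hz : z ∈ W) (hzx : z ≠ x)
    (hzy : z ≠ y) (hxz : ¬ G.Adj x z) (ht : t ∈ W) (hxt : G.Adj x t) (hzt : G.Adj z t)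
    (hyz : G.Adj y z) (hN : ∀ w ∈ W, G.Adj z w → w = y ∨ w = t) : False := by
  have hxW := h.1
  have hyW := h.2.1
  have hxy' := h.2.2.1
  have hty : t ≠ y := by rintro rfl; exact hxy hxt
  have htri := hxt.ne
  have htz := hzt.ne
  by_cases hall : ∀ v ∈ W, v ≠ x → v ≠ z → ReachIn G ((W.erase x).erase z) v y
  · have hroot : Rooted G (W.erase z) x y := by
      refine ⟨by grind, by grind, hxy', fun c v hv hvx hvy hvc => ?_⟩
      by_cases hcx : c = x
      · exact .inr ((hall v (by grind) hvx (by grind)).mono (by grind))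
      rcases h.2.2.2 c v (by grind) hvx hvy hvc with hr | hr
      · refine .inl ((hr.avoid_hanging (A := {z}) (d := t) (by grind) (by grind) ?_).mono
          (by grind))
        intro a ha w hw haw
        rw [Finset.mem_singleton] at ha
        subst ha
        rcases hN w (by grind) haw with h | h
        · grind
        · exact .inr h
      · obtain ⟨b, hb, w, hw, hwB, hbw, hr'⟩ :=
          hr.exists_exit (B := ((W.erase c).erase x) \ {y, z}) (by grind) (by grind)
        have hw' : w = y ∨ w = z := by grind
        rcases hw' with rfl | rfl
        · exact .inr ((hr'.mono (by grind)).tail hbw (by grind))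
        · rcases hN b (by grind) hbw.symm with h | rfl
          · grind
          · exact .inl ((hr'.mono (by grind)).tail hxt.symm (by grind))
    have h3 := hdeg t ht htri.symm hty htz.symm
    obtain ⟨r, hr, htr, hr'⟩ := exists_nbr_notMem (S := {x, z}) (v := t) (G := G) (W := W)
      (Finset.card_le_two.trans_lt (by omega))
    have hry : r ≠ y := by
      rintro rfl
      exact hno (two_of_triangle h.symm ht hz htri.symm hzx htr.symm hyz hzt.symm).symm
    refine hno ((IH G (W.erase z) x y t (Finset.card_erase_lt_of_mem hz) hroot
      ⟨r, by grind, by grind, hry, htr.ne'⟩ ?_).mono (Finset.erase_subset _ _))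
    intro u hu hux huy hut
    refine (hdeg u (by grind) hux huy (by grind)).trans (nbr_card_le fun w hw huw => ⟨?_, huw⟩)
    rw [Finset.mem_erase]
    refine ⟨?_, hw⟩
    rintro rfl
    rcases hN u (by grind) huw.symm with h | h
    · exact huy h
    · exact hut h
  · push Not at hall
    obtain ⟨v, hv, hvx, hvz, hr⟩ := hall
    have hA : ∀ a, a ∈ comp G ((W.erase x).erase z) v → a ∈ W ∧ a ≠ x ∧ a ≠ z := by
      intro a ha
      have := comp_subset ha
      grind
    refine hno (IH.of_sub h hdeg (A := comp G ((W.erase x).erase z) v) (q := z) (v := v)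
      (w := y) (fun a ha => (hA a ha).1) (fun ha => (hA x ha).2.1 rfl) ?_ hz
      (fun ha => (hA z ha).2.2 rfl) hzx ?_ (self_mem_comp (by grind)) hvz hyW ?_ hxy'.symm
      hzy.symm)
    · exact fun ha => hr (mem_comp.1 ha).2.symm
    · intro a ha w hw haw
      by_cases h1 : w = x
      · exact .inr (.inl h1)
      by_cases h2 : w = z
      · exact .inr (.inr h2)
      exact .inl (comp_closed ha (by grind) haw)
    · exact fun ha => hr (mem_comp.1 ha).2.symm

lemma nbr_subset (hxy : ¬ G.Adj x y) (hno : ¬ Adm G W x y 2) (hv : v ∈ W) (hvx : v ≠ x)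
    (hvy : v ≠ y) :
    ∀ w ∈ W, G.Adj y w → G.Adj x w := by
  have hxW := h.1
  have hyW := h.2.1
  have hxy' := h.2.2.1
  obtain ⟨v₀, hv₀, -, hxv₀⟩ := (h.reach hv hvx hvy).exists_adj hxy'
  set T := nbr G W x with hT
  have hTm : ∀ w, w ∈ T ↔ w ∈ W ∧ G.Adj x w := fun w => mem_nbr
  have hyT : y ∉ T := fun hy => hxy ((hTm y).1 hy).2
  have hxT : x ∉ T := fun hx => ((hTm x).1 hx).2.ne rfl
  set P := (comp G ((W \ T).erase x) y).erase y with hP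
  have hPm : ∀ v ∈ P, v ∈ W ∧ v ∉ T ∧ v ≠ x ∧ v ≠ y := by
    intro v hv
    have := comp_subset (Finset.mem_of_mem_erase hv)
    grind
  have hyc : y ∈ comp G ((W \ T).erase x) y := self_mem_comp (by grind)
  have hins : insert y P = comp G ((W \ T).erase x) y := Finset.insert_erase hyc
  have hPN : ∀ a ∈ insert y P, ∀ w ∈ W, G.Adj a w → w ∈ P ∨ w ∈ T ∨ w = y := by
    intro a ha w hw haw
    by_cases hwT : w ∈ T
    · exact .inr (.inl hwT)
    by_cases hwx : w = x
    · subst hwx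
      rw [hins] at ha
      have := comp_subset ha
      have := (hTm a).2 ⟨by grind, haw.symm⟩
      grind
    rw [hins] at ha
    have := comp_closed ha (w := w) (by grind) haw
    grind
  have h₁ : ∀ v ∈ P, ReachIn G (insert y P) v y := by
    intro v hv
    rw [hins]
    exact comp_reach (Finset.mem_of_mem_erase hv)
  by_cases hr : ∃ r ∈ P, r ≠ z
  · obtain ⟨r, hr, hrz⟩ := hr
    refine absurd ((IH.of_contr h hdeg (P := P) (E := T) (c := y) (w := v₀) hno hxy
      (fun v hv => (hPm v hv).1) hyW ?_ hxy'.symm ?_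
      (fun a ha => hPN a (Finset.mem_insert_of_mem ha)) h₁ hv₀ ?_ hxv₀.ne' ?_ hr hrz).mono ?_) hno
    · intro v hv
      obtain ⟨h1, h2, h3, h4⟩ := hPm v hv
      exact ⟨h3, h4, fun hxv => h2 ((hTm v).2 ⟨h1, hxv⟩), h4⟩
    · intro e he
      exact ⟨((hTm e).1 he).1, ((hTm e).1 he).2, by grind⟩
    · exact fun hv => (hPm _ hv).2.1 ((hTm _).2 ⟨hv₀, hxv₀⟩)
    · rintro rfl
      exact hxy hxv₀
    · have hTW : T ⊆ W := fun e he => ((hTm e).1 he).1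
      have hPW : P ⊆ W := fun e he => (hPm e he).1
      grind
  push Not at hr
  intro w hw hyw
  rcases hPN y (Finset.mem_insert_self _ _) w hw hyw with hwP | hwT | rfl
  · exfalso
    have hwz := hr w hwP
    subst hwz
    obtain ⟨hw1, hw2, hw3, hw4⟩ := hPm w hwP
    have hxw : ¬ G.Adj x w := fun hxw => hw2 ((hTm w).2 ⟨hw, hxw⟩)
    obtain ⟨b, hb, t, ht, htP, hty, hbt, -⟩ := h.exit (A := {w}) (by simpa using hw)
      (by simpa using hw3.symm) (by simpa using hw4.symm) (Finset.mem_singleton_self w) hw4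
    rw [Finset.mem_singleton] at hb
    subst hb
    have htT : t ∈ T := by
      rcases hPN b (Finset.mem_insert_of_mem hwP) t ht hbt with h | h | h
      · exact absurd (hr t h) (by simpa using htP)
      · exact h
      · exact absurd h hty
    refine IH.of_pendant h hdeg hxy hno hw hw3 hw4 hxw ht ((hTm t).1 htT).2 hbt hyw ?_
    intro u hu hbu
    rcases hPN b (Finset.mem_insert_of_mem hwP) u hu hbu with h' | h' | h'
    · exact absurd (hr u h') hbu.ne'
    · have := IH.nbr_le_one h hdeg (E := T) hno hxy hw hw3 hw4 hxw
        (fun e he => (hTm e).1 he)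
      rw [Finset.card_le_one] at this
      exact .inr (this u (by simp [h', hbu]) t (by simp [htT, hbt]))
    · exact .inl h'
  · exact ((hTm w).1 hwT).2
  · exact absurd rfl hyw.ne

lemma of_not_adj (hxy : ¬ G.Adj x y) (hv : v ∈ W) (hvx : v ≠ x) (hvy : v ≠ y) (hvz : v ≠ z) :
    Adm G W x y 2 := by
  by_contra hno
  have hxW := h.1
  have hyW := h.2.1
  have hxy' := h.2.2.1
  have hyx : ∀ w ∈ W, G.Adj y w → G.Adj x w := IH.nbr_subset h hdeg hxy hno hv hvx hvy
  have hxyN : ∀ w ∈ W, G.Adj x w → G.Adj y w :=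
    IH.nbr_subset h.symm (fun v hv h1 h2 => hdeg v hv h2 h1) (fun h => hxy h.symm)
      (fun h => hno h.symm) hv hvy hvx
  have htri : ∀ a ∈ W, ∀ b ∈ W, G.Adj x a → G.Adj x b → ¬ G.Adj a b := by
    intro a ha b hb hxa hxb hab
    exact hno (two_of_triangle h ha hb (by rintro rfl; exact hxy hxa)
      (by rintro rfl; exact hxy hxb) hxa hxb hab)
  have third : ∀ b ∈ W, G.Adj x b → b ≠ z →
      ∃ r ∈ W, G.Adj b r ∧ r ≠ x ∧ r ≠ y ∧ ¬ G.Adj x r := by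
    intro b hb hxb hbz
    have h3 := hdeg b hb hxb.ne' (by rintro rfl; exact hxy hxb) hbz
    obtain ⟨r, hr, hbr, hr'⟩ := exists_nbr_notMem (S := {x, y}) (v := b) (G := G) (W := W)
      (Finset.card_le_two.trans_lt (by omega))
    exact ⟨r, hr, hbr, by grind, by grind, fun hxr => htri b hb r hr hxb hxr hbr⟩
  have hone : ∀ a, (∀ b ∈ W, G.Adj x b → b = a) → ∀ v ∈ W, v ≠ x → v ≠ y → v ≠ a → False := by
    intro a ha v hv hvx hvy hva
    have key : ∀ p q, (∀ b ∈ W, G.Adj p b → b = a) → v ≠ p →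
        ¬ ReachIn G ((W.erase a).erase q) v p := by
      intro p q hp hvp hr
      obtain ⟨w, hw, -, hpw⟩ := hr.symm.exists_adj hvp.symm
      exact absurd (hp w (by grind) hpw) (by grind)
    rcases h.2.2.2 a v hv hvx hvy hva with hr | hr
    · exact key x y ha hvx hr
    · exact key y x (fun b hb hyb => ha b hb (hyx b hb hyb)) hvy hr
  by_cases hb : ∃ b ∈ W, G.Adj x b ∧ ∃ r ∈ W, G.Adj b r ∧ r ≠ x ∧ r ≠ y ∧ ¬ G.Adj x r ∧ r ≠ z
  · obtain ⟨b, hb, hxb, r, hr, hbr, hrx, hry, hxr, hrz⟩ := hb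
    set Z := (W \ nbr G W x) \ {x, y} with hZ
    have hrZ : r ∈ Z := by simp [hZ, hr, hrx, hry, hxr]
    have hPm : ∀ v ∈ comp G Z r, v ∈ W ∧ ¬ G.Adj x v ∧ v ≠ x ∧ v ≠ y := by
      intro v hv
      have := comp_subset hv
      simp [hZ] at this
      grind
    have hby : b ≠ y := by rintro rfl; exact hxy hxb
    have hadm := IH.of_contr h hdeg (P := comp G Z r) (E := (nbr G W x).erase b) (c := b) (w := y)
      hno hxy (fun v hv => (hPm v hv).1) hb ?_ hxb.ne' ?_ ?_ ?_ hyW ?_ hxy'.symm hby.symm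
      (self_mem_comp hrZ) hrz
    · refine hno (hadm.then_reach (B := {b, y}) ⟨1, PathIn.adj (hxyN b hb hxb).symm⟩ ?_ ?_ ?_)
      · intro a ha hab
        have h1 : y ∉ comp G Z r := fun hy => (hPm y hy).2.2.2 rfl
        have h2 : y ∉ nbr G W x := fun hy => hxy (mem_nbr.1 hy).2
        grind
      · have h1 : nbr G W x ⊆ W := fun a ha => (mem_nbr.1 ha).1
        have h2 : comp G Z r ⊆ W := fun a ha => (hPm a ha).1
        grind
      · grind
    · intro v hv
      obtain ⟨h1, h2, h3, h4⟩ := hPm v hv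
      exact ⟨h3, h4, h2, by rintro rfl; exact h2 hxb⟩
    · intro e he
      rw [Finset.mem_erase, mem_nbr] at he
      exact ⟨he.2.1, he.2.2, he.1⟩
    · intro a ha w hw haw
      obtain ⟨h1, h2, h3, h4⟩ := hPm a ha
      by_cases hwb : w = b
      · exact .inr (.inr hwb)
      by_cases hxw : G.Adj x w
      · exact .inr (.inl (by simp [hwb, hxw, hw]))
      refine .inl (comp_closed ha ?_ haw)
      simp only [hZ, Finset.mem_sdiff, mem_nbr, Finset.mem_insert, Finset.mem_singleton]
      refine ⟨⟨hw, fun h => hxw h.2⟩, ?_⟩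
      rintro (rfl | rfl)
      · exact h2 haw.symm
      · exact h2 (hyx a h1 haw.symm)
    · intro v hv
      exact ((comp_reach hv).mono (Finset.subset_insert _ _)).tail hbr.symm (by simp)
    · exact fun hy => (hPm y hy).2.2.2 rfl
  · have hb' : ∀ b ∈ W, G.Adj x b → b ≠ z → G.Adj b z ∧ z ∈ W ∧ z ≠ x ∧ z ≠ y ∧ ¬ G.Adj x z := by
      intro b hbW hxb hbz
      obtain ⟨r, hr, hbr, hrx, hry, hxr⟩ := third b hbW hxb hbz
      by_cases hrz : r = z
      · subst hrz
        exact ⟨hbr, hr, hrx, hry, hxr⟩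
      · exact absurd ⟨b, hbW, hxb, r, hr, hbr, hrx, hry, hxr, hrz⟩ hb
    by_cases ha : ∃ a ∈ W, G.Adj x a ∧ a ≠ z
    · obtain ⟨a, ha, hxa, haz⟩ := ha
      obtain ⟨h1, h2, h3, h4, h5⟩ := hb' a ha hxa haz
      refine hone a (fun b hb hxb => ?_) z h2 h3 h4 haz.symm
      by_contra hba
      have hbz : b ≠ z := by rintro rfl; exact h5 hxb
      exact IH.no_square h hdeg hno ha hb h2 (by rintro rfl; exact hxy hxa)
        (by rintro rfl; exact hxy hxb) h4 h3 (Ne.symm hba) hxa hxb h1.symm (hb' b hb hxb hbz).1.symm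
    · push Not at ha
      exact hone z ha v hv hvx hvy hvz

end TwoPathsBelow

theorem twoPaths (N : ℕ) : TwoPathsBelow V N := by
  induction N with
  | zero => exact fun _ _ _ _ _ h => absurd h (by omega)
  | succ N ih =>
    rintro G W x y z hW h ⟨v, hv, hvx, hvy, hvz⟩ hdeg
    obtain ⟨G', hle, hxy, hG'⟩ := exists_deleteEdge G x y
    have h' := h.congr hG'
    refine (TwoPathsBelow.of_not_adj (z := z) (fun G W' x y z hW' => ih G W' x y z (by omega))
      h' ?_ hxy hv hvx hvy hvz).congr fun a _ b _ hab => hle hab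
    intro u hu hux huy huz
    exact (hdeg u hu hux huy huz).trans
      (nbr_card_le fun w hw huw => ⟨hw, hG' u w (by grind) (by grind) huw⟩)

end TwoPaths2

section ManyPaths

variable {V : Type*} [DecidableEq V]
variable {G G' : SimpleGraph V} {W A B Z E H P Q S U : Finset V}
  {b c d e p q r s t u v w x y z : V} {k l m n N : ℕ}

lemma Rooted.adm_one (h : Rooted G W x y) (hv : v ∈ W) (hvx : v ≠ x) (hvy : v ≠ y) :
    Adm G W x y 1 :=
  (h.reach hv hvx hvy).adm

/-- The statement, for sets with fewer than `N` vertices, that a rooted graph all whose vertices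
except the roots have degree greater than `k` has `k` admissible paths. -/
def PathsBelow (V : Type*) [DecidableEq V] (N : ℕ) : Prop :=
  ∀ (G : SimpleGraph V) (W : Finset V) (x y : V) (k : ℕ), W.card < N → Rooted G W x y →
    (∃ v ∈ W, v ≠ x ∧ v ≠ y) →
    (∀ v ∈ W, v ≠ x → v ≠ y → k + 1 ≤ (nbr G W v).card) → Adm G W x y k

/-- A minimal counterexample to the existence of `k` admissible paths. -/
structure Critical (G : SimpleGraph V) (W : Finset V) (x y : V) (k : ℕ) : Prop where
  below : PathsBelow V W.card
  rooted : Rooted G W x y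
  deg : ∀ v ∈ W, v ≠ x → v ≠ y → k + 1 ≤ (nbr G W v).card
  not_adj : ¬ G.Adj x y
  three_le : 3 ≤ k
  exists_mem : ∃ v ∈ W, v ≠ x ∧ v ≠ y
  not_adm : ¬ Adm G W x y k

namespace Critical

variable (C : Critical G W x y k)

include C

lemma symm : Critical G W y x k :=
  ⟨C.below, C.rooted.symm, fun v hv h1 h2 => C.deg v hv h2 h1, fun h => C.not_adj h.symm,
    C.three_le, C.exists_mem.imp fun _ h => ⟨h.1, h.2.2, h.2.1⟩, fun h => C.not_adm h.symm⟩

lemma x_mem : x ∈ W := C.rooted.1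

lemma y_mem : y ∈ W := C.rooted.2.1

lemma ne : x ≠ y := C.rooted.2.2.1

lemma adm_sub (hA : A ⊆ W) (hx : x ∉ A) (hy : y ∉ A) (hv : v ∈ A) (hp : p ∈ W) (hq : q ∈ W)
    (hpA : p ∉ A) (hqA : q ∉ A) (hpq : p ≠ q)
    (hN : ∀ a ∈ A, ∀ w ∈ W, G.Adj a w → w ∈ A ∨ w = p ∨ w = q)
    (hw : w ∈ W) (hwA : w ∉ A) (hwp : w ≠ p) (hwq : w ≠ q) : Adm G (A ∪ {p, q}) p q k := by
  refine C.below G _ p q k (card_lt_of_mem (by grind) hw (by grind))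
    (C.rooted.sub hA hx hy hpA hqA hpq hN) ⟨v, by grind⟩ ?_
  intro u hu hup huq
  have huA : u ∈ A := by grind
  refine (C.deg u (hA huA) (by grind) (by grind)).trans (nbr_card_le fun w hw huw => ⟨?_, huw⟩)
  have := hN u huA w hw huw
  grind

lemma false_of_sub (hA : A ⊆ W) (hx : x ∉ A) (hy : y ∉ A) (hv : v ∈ A) (hq : q ∈ W)
    (hqA : q ∉ A) (hqx : q ≠ x) (hN : ∀ a ∈ A, ∀ w ∈ W, G.Adj a w → w ∈ A ∨ w = x ∨ w = q)
    (hw : w ∈ W) (hwA : w ∉ A) (hwx : w ≠ x) (hwq : w ≠ q) : False :=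
  C.not_adm (C.rooted.extend hA hy hq hqA hqx hN
    (C.adm_sub hA hx hy hv C.x_mem hq hx hqA hqx.symm hN hw hwA hwx hwq))

lemma false_of_sub' (hA : A ⊆ W) (hx : x ∉ A) (hy : y ∉ A) (hv : v ∈ A)
    (hqA : q ∉ A) (hN : ∀ a ∈ A, ∀ w ∈ W, G.Adj a w → w ∈ A ∨ w = x ∨ w = q)
    (hw : w ∈ W) (hwA : w ∉ A) (hwx : w ≠ x) (hwy : w ≠ y) (hwq : w ≠ q) : False := by
  by_cases hq : q ∈ W ∧ q ≠ x
  · exact C.false_of_sub hA hx hy hv hq.1 hqA hq.2 hN hw hwA hwx hwq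
  · refine C.false_of_sub hA hx hy hv C.y_mem hy C.ne.symm ?_ hw hwA hwx hwy
    intro a ha w hw haw
    rcases hN a ha w hw haw with h | h | rfl
    · exact .inl h
    · exact .inr (.inl h)
    · exact .inr (.inl (by grind))

lemma exists_adj : ∃ w ∈ W, G.Adj x w ∧ w ≠ y := by
  obtain ⟨v, hv, hvx, hvy⟩ := C.exists_mem
  obtain ⟨w, hw, -, hxw⟩ := (C.rooted.reach hv hvx hvy).exists_adj C.ne
  exact ⟨w, hw, hxw, by rintro rfl; exact C.not_adj hxw⟩

lemma exists_adj_notMem (hv : v ∈ W) (hvx : v ≠ x) (hvy : v ≠ y) (hS : S.card ≤ k) :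
    ∃ w ∈ W, G.Adj v w ∧ w ∉ S :=
  exists_nbr_notMem (lt_of_le_of_lt hS (C.deg v hv hvx hvy))

lemma false_of_pendant (hb : ∀ w ∈ W, G.Adj y w → w = b) : False := by
  obtain ⟨w, hw, hyw, hwx⟩ := C.symm.exists_adj
  obtain rfl := hb w hw hyw
  obtain ⟨v, hv, hvx, hvy⟩ := C.exists_mem
  obtain ⟨u, hu, hvu, huS⟩ := C.exists_adj_notMem (S := {x, y, w}) hv hvx hvy
    (Finset.card_le_three.trans C.three_le)
  refine C.false_of_sub (A := W \ {x, y, w}) (q := w) (w := y) (v := u) Finset.sdiff_subset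
    (by simp) (by simp) (by grind) hw (by simp) hwx ?_ C.y_mem (by simp) C.ne.symm hyw.ne
  intro a ha u hu hau
  by_cases hua : u = y
  · subst hua
    have := hb a (by grind) hau.symm
    grind
  · grind

end Critical

/-- A core `H` at `x`, and a set `U` avoiding it which meets the rest only at `b`, the vertex
at which paths to `y` leave `U`. -/
structure Frame (G : SimpleGraph V) (W : Finset V) (x y : V) (H U : Finset V) (b : V) :
    Prop where
  H_subset : H ⊆ W
  x_mem : x ∈ H
  y_notMem : y ∉ H
  U_subset : U ⊆ W
  disj : ∀ a ∈ U, a ∉ H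
  b_mem : b ∈ U
  closed : ∀ a ∈ U, a ≠ b → ∀ w ∈ W, G.Adj a w → w ∈ U ∨ w ∈ H
  to_y : b = y ∨ (G.Adj b y ∧ y ∉ U)

lemma Frame.of_right (hH : H ⊆ W) (hx : x ∈ H) (hy : y ∈ W) (hyH : y ∉ H) :
    Frame G W x y H (W \ H) y :=
  ⟨hH, hx, hyH, Finset.sdiff_subset, by simp, by simp [hy, hyH], by grind, .inl rfl⟩

lemma Frame.of_adj (hH : H ⊆ W) (hx : x ∈ H) (hyH : y ∉ H) (hb : b ∈ W) (hbH : b ∉ H)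
    (hyb : G.Adj y b) (hyN : ∀ w ∈ W, G.Adj y w → w ∈ H ∨ w = b) :
    Frame G W x y H ((W \ H).erase y) b := by
  refine ⟨hH, hx, hyH, by grind, by grind, ?_, ?_, .inr ⟨hyb.symm, by simp⟩⟩
  · have := hyb.ne
    grind
  · intro a ha hab w hw haw
    by_cases hwy : w = y
    · subst hwy
      have := hyN a (by grind) haw.symm
      grind
    · grind

/-- A part `P` of `U` attached to the rest through `c` and the core only. -/
structure Piece (G : SimpleGraph V) (W H U : Finset V) (b : V) (P : Finset V) (c : V) :
    Prop where
  nonempty : P.Nonempty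
  subset : P ⊆ U.erase b
  c_mem : c ∈ U
  c_notMem : c ∉ P
  closed : ∀ a ∈ P, ∀ w ∈ W, G.Adj a w → w ∈ P ∨ w ∈ H ∨ w = c
  reach : ∀ v ∈ P, ReachIn G (insert c P) v c
  to_b : ReachIn G (U \ P) c b

lemma Frame.exists_piece (F : Frame G W x y H U b) (hr : r ∈ U) (hbr : G.Adj b r) :
    ∃ P c, Piece G W H U b P c := by
  have hb := self_mem_comp (G := G) F.b_mem
  refine ⟨(comp G U b).erase b, b, ⟨r, ?_⟩, ?_, F.b_mem, by simp, ?_, ?_, .refl ?_⟩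
  · exact Finset.mem_erase.2 ⟨hbr.ne', comp_closed hb hr hbr⟩
  · exact Finset.erase_subset_erase _ comp_subset
  · intro a ha w hw haw
    rw [Finset.mem_erase] at ha
    rcases F.closed a (comp_subset ha.2) ha.1 w hw haw with h | h
    · have := comp_closed ha.2 h haw
      grind
    · exact .inr (.inl h)
  · intro v hv
    rw [Finset.insert_erase hb]
    exact comp_reach (Finset.mem_of_mem_erase hv)
  · have := F.b_mem
    grind

/-- A piece with the least number of vertices. -/
structure MinPiece (G : SimpleGraph V) (W H U : Finset V) (b : V) (P : Finset V) (c : V) : Prop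
    extends Piece G W H U b P c where
  min : ∀ P' c', Piece G W H U b P' c' → P.card ≤ P'.card

lemma Frame.exists_minPiece (F : Frame G W x y H U b) (hr : r ∈ U) (hbr : G.Adj b r) :
    ∃ P c, MinPiece G W H U b P c := by
  classical
  have hex : ∃ n, ∃ P c, Piece G W H U b P c ∧ P.card = n := by
    obtain ⟨P, c, h⟩ := F.exists_piece hr hbr
    exact ⟨_, P, c, h, rfl⟩
  obtain ⟨P, c, h, hn⟩ := Nat.find_spec hex
  exact ⟨P, c, h, fun P' c' h' => hn ▸ Nat.find_min' hex ⟨P', c', h', rfl⟩⟩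

namespace MinPiece

variable (M : MinPiece G W H U b P c)

include M

lemma reach_avoiding (hd : d ∈ P) (hv : v ∈ P) (hvd : v ≠ d) :
    ReachIn G ((insert c P).erase d) v c := by
  classical
  by_contra hcon
  have hcP := M.c_notMem
  have hPU := M.subset
  set A := (P.erase d).filter fun u => ¬ ReachIn G ((insert c P).erase d) u c with hA
  have hAm : ∀ u, u ∈ A ↔ u ∈ P ∧ u ≠ d ∧ ¬ ReachIn G ((insert c P).erase d) u c := by
    intro u
    simp [hA]
    tauto
  have hAP : A ⊆ P := fun u hu => ((hAm u).1 hu).1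
  have hcA : c ∉ A := fun h => hcP (hAP h)
  have hdA : d ∉ A := by simp [hA]
  have hcl : ∀ a ∈ A, ∀ w ∈ insert c P, G.Adj a w → w ∈ A ∨ w = d := by
    intro a ha w hw haw
    obtain ⟨h1, h2, h3⟩ := (hAm a).1 ha
    by_cases hwd : w = d
    · exact .inr hwd
    have hwr : ¬ ReachIn G ((insert c P).erase d) w c := fun h => h3 (.head (by grind) haw h)
    have hwc : w ≠ c := by
      rintro rfl
      exact hwr (.refl (by grind))
    exact .inl ((hAm w).2 ⟨by grind, hwd, hwr⟩)
  have hvA : v ∈ A := (hAm v).2 ⟨hv, hvd, hcon⟩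
  have hreach : ∀ u ∈ A, ReachIn G (insert d A) u d := by
    intro u hu
    obtain ⟨a, ha, w, hw, hwA, haw, hr⟩ := (M.reach u (hAP hu)).exists_exit hu hcA
    obtain rfl : w = d := by have := hcl a ha w hw haw; grind
    exact (hr.mono (by grind)).tail haw (by grind)
  have hpiece : Piece G W H U b A d := by
    refine ⟨⟨v, hvA⟩, hAP.trans hPU, by grind, hdA, ?_, hreach, ?_⟩
    · intro a ha w hw haw
      have := M.closed a (hAP ha) w hw haw
      have := hcl a ha w
      grind
    · have h1 := (M.reach d hd).avoid_hanging hdA hcA hcl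
      have hcU := M.c_mem
      exact (h1.mono (by grind)).trans (M.to_b.mono (by grind))
  have h1 := M.min A d hpiece
  have h2 := card_lt_of_mem hAP hd hdA
  omega

lemma touch (he : ∃ u ∈ P, ∃ e ∈ E, G.Adj e u) (hv : v ∈ P) :
    ∃ u ∈ P, (∃ e ∈ E, G.Adj e u) ∧ ReachIn G P v u := by
  classical
  by_contra hcon
  have hcP := M.c_notMem
  have hPU := M.subset
  set A := P.filter fun v => ¬ ∃ u ∈ P, (∃ e ∈ E, G.Adj e u) ∧ ReachIn G P v u with hA
  have hAm : ∀ u, u ∈ A ↔ u ∈ P ∧ ¬ ∃ w ∈ P, (∃ e ∈ E, G.Adj e w) ∧ ReachIn G P u w := by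
    intro u
    rw [hA, Finset.mem_filter]
  have hAP : A ⊆ P := fun u hu => ((hAm u).1 hu).1
  have hcA : c ∉ A := fun h => hcP (hAP h)
  have hcl : ∀ a ∈ A, ∀ w ∈ P, G.Adj a w → w ∈ A := by
    intro a ha w hw haw
    refine (hAm w).2 ⟨hw, ?_⟩
    rintro ⟨u, hu, hue, hr⟩
    exact ((hAm a).1 ha).2 ⟨u, hu, hue, .head (hAP ha) haw hr⟩
  have hpiece : Piece G W H U b A c := by
    refine ⟨⟨v, (hAm v).2 ⟨hv, hcon⟩⟩, hAP.trans hPU, M.c_mem, hcA, ?_, ?_, ?_⟩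
    · intro a ha w hw haw
      rcases M.closed a (hAP ha) w hw haw with h | h | h
      · exact .inl (hcl a ha w h haw)
      · exact .inr (.inl h)
      · exact .inr (.inr h)
    · intro u hu
      obtain ⟨a, ha, w, hw, hwA, haw, hr⟩ := (M.reach u (hAP hu)).exists_exit hu hcA
      obtain rfl : w = c := by have := hcl a ha w; grind
      exact (hr.mono (by grind)).tail haw (by grind)
    · exact M.to_b.mono (by grind)
  obtain ⟨u, hu, hue⟩ := he
  have huA : u ∉ A := fun h => ((hAm u).1 h).2 ⟨u, hu, hue, .refl hu⟩
  have h1 := M.min A c hpiece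
  have h2 := card_lt_of_mem hAP hu huA
  omega

end MinPiece

lemma Frame.reach_y (F : Frame G W x y H U b) (M : Piece G W H U b P c) :
    ReachIn G (insert y (U \ P)) c y := by
  have hr := M.to_b
  rcases F.to_y with rfl | ⟨hby, hyU⟩
  · exact hr.mono (by grind)
  · exact (hr.mono (by grind)).tail hby (by grind)

lemma Frame.y_notMem_piece (F : Frame G W x y H U b) (M : Piece G W H U b P c) : y ∉ P := by
  intro hy
  have := M.subset hy
  rcases F.to_y with rfl | ⟨hby, hyU⟩ <;> grind

namespace Critical

variable (C : Critical G W x y k) (F : Frame G W x y H U b) (M : MinPiece G W H U b P c)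

include C F M

lemma not_touch (hE : E ⊆ H) (he : e ∈ E) (hex : e ≠ x)
    (hcore : ∃ a d : ℕ, (d = 1 ∨ d = 2) ∧ ∀ e ∈ E, ∀ i < l + 1, PathIn G H x e (a + i * d))
    (hl : ∀ u ∈ P, (nbr G H u).card ≤ l ∨ (∃ e ∈ E, G.Adj e u) ∧ (nbr G H u).card ≤ l + 1) :
    ∀ u ∈ P, ∀ e ∈ E, ¬ G.Adj e u := by
  by_contra hcon
  push Not at hcon
  have hcP := M.c_notMem
  have hPU := M.subset
  have hcU := M.c_mem
  have hdisj := F.disj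
  have hxH := F.x_mem
  have hUW := F.U_subset
  have hHW := F.H_subset
  have hyP := F.y_notMem_piece M.toPiece
  have hyH := F.y_notMem
  have hcH : c ∉ H := hdisj c hcU
  have hPH : ∀ v ∈ P, v ∉ H := fun v hv => hdisj v (Finset.mem_of_mem_erase (hPU hv))
  have hcx : c ≠ x := by grind
  have hxP : x ∉ P := fun h => hPH x h hxH
  have hroot : Rooted (contr G x E) (P ∪ {x, c}) x c :=
    contr_rooted hxP M.c_notMem hcx M.reach (fun v hv => M.touch hcon hv)
      fun d hd v hv hvd => .inl (M.reach_avoiding hd hv hvd)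
  obtain ⟨v, hv⟩ := M.nonempty
  have hsub : P ∪ {x, c} ⊆ W := by
    have hxW := C.x_mem
    grind
  have hcard : (P ∪ {x, c}).card < W.card :=
    card_lt_of_mem hsub (hHW (hE he)) (by grind)
  have hadm : ∃ m, 1 ≤ m ∧ k ≤ m + (l + 1) - 1 ∧ Adm (contr G x E) (P ∪ {x, c}) x c m := by
    rcases Nat.lt_or_ge l k with hlk | hlk
    · refine ⟨k - l, by omega, by omega, C.below _ _ x c _ hcard hroot ⟨v, by grind⟩ ?_⟩
      intro u hu hux huc
      have huP : u ∈ P := by grind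
      have h1 := C.deg u (hsub hu) hux (by grind)
      have h2 := contr_nbr (G := G) (W := W) hxP hcx huP (M.closed u huP) (hl u huP)
      omega
    · exact ⟨1, le_rfl, by omega, hroot.adm_one (v := v) (by grind) (by grind) (by grind)⟩
  obtain ⟨m, hm, hkm, hadm⟩ := hadm
  have := contr_lift hcx hPH hcH hcore hadm hm (by omega) hkm
  refine C.not_adm (this.then_reach (F.reach_y M.toPiece) ?_ ?_ ?_)
  · intro a ha hab
    grind
  · grind
  · have hyW := C.y_mem
    grind

lemma exists_touch (he : e ∈ H) (hex : e ≠ x) : ∃ u ∈ P, ∃ e ∈ H, e ≠ x ∧ G.Adj e u := by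
  by_contra hcon
  push Not at hcon
  have hPU := M.subset
  have hcU := M.c_mem
  have hdisj := F.disj
  have hxH := F.x_mem
  have hUW := F.U_subset
  have hPH : ∀ v ∈ P, v ∉ H := fun v hv => hdisj v (Finset.mem_of_mem_erase (hPU hv))
  obtain ⟨v, hv⟩ := M.nonempty
  refine C.false_of_sub (A := P) (q := c) (w := e) (fun v hv => by grind)
    (fun h => hPH x h hxH) (F.y_notMem_piece M.toPiece) hv (hUW hcU) M.c_notMem (by grind) ?_
    (F.H_subset he) (by grind) hex (by grind)
  intro a ha w hw haw
  rcases M.closed a ha w hw haw with h | h | h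
  · exact .inl h
  · by_cases hwx : w = x
    · exact .inr (.inl hwx)
    · exact absurd haw.symm (hcon a ha w h hwx)
  · exact .inr (.inr h)

end Critical

end ManyPaths

section CliqueCores

variable {V : Type*} [DecidableEq V]
variable {G G' : SimpleGraph V} {W A B Z E H K P Q S U : Finset V}
  {b c d e p q r s t t' u v w x y z : V} {k l m n N : ℕ}

/-- The vertices of `K` are pairwise adjacent. -/
def Clq (G : SimpleGraph V) (K : Finset V) : Prop := ∀ a ∈ K, ∀ b ∈ K, a ≠ b → G.Adj a b

lemma Clq.path (h : Clq G K) (hx : x ∈ K) (he : e ∈ K) (hex : e ≠ x) (hn : n + 1 < K.card) :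
    PathIn G K x e (n + 1) := by
  induction n generalizing K x with
  | zero => exact (PathIn.adj (h x hx e he hex.symm)).mono (by grind)
  | succ n ih =>
    obtain ⟨f, hf, hfx⟩ := Finset.exists_mem_notMem_of_card_lt_card (s := {x, e}) (t := K)
      (Finset.card_le_two.trans_lt (by omega))
    refine .cons hx (h x hx f hf (by grind)) (ih ?_ (by grind) (by grind) (by grind) ?_)
    · intro a ha b hb
      exact h a (Finset.mem_of_mem_erase ha) b (Finset.mem_of_mem_erase hb)
    · rw [Finset.card_erase_of_mem hx]
      omega

lemma Clq.insert (h : Clq G K) (hv : ∀ a ∈ K, G.Adj a v) : Clq G (insert v K) := by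
  intro a ha b hb hab
  rw [Finset.mem_insert] at ha hb
  rcases ha with rfl | ha <;> rcases hb with rfl | hb
  · exact absurd rfl hab
  · exact (hv b hb).symm
  · exact hv a ha
  · exact h a ha b hb hab

lemma Clq.mono (h : Clq G K) (hH : H ⊆ K) : Clq G H :=
  fun a ha b hb => h a (hH ha) b (hH hb)

lemma nbr_card_lt (ha : v ∈ H) (hv : ¬ G.Adj u v) : (nbr G H u).card + 1 ≤ H.card :=
  Finset.card_lt_card (Finset.ssubset_iff_subset_ne.2 ⟨fun _ hw => (mem_nbr.1 hw).1, fun h =>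
    hv (mem_nbr.1 (h ▸ ha)).2⟩)

lemma nbr_card_le_of_subset (h : ∀ v ∈ H, G.Adj u v → v ∈ S) : (nbr G H u).card ≤ S.card :=
  Finset.card_le_card fun v hv => h v (mem_nbr.1 hv).1 (mem_nbr.1 hv).2

/-- A clique containing `v` with the largest number of vertices. -/
lemma exists_max_clq (h : Clq G K) (p : Finset V → Prop) (hp : p K) (hK : K ⊆ W) :
    ∃ K', Clq G K' ∧ p K' ∧ K' ⊆ W ∧ K.card ≤ K'.card ∧
      ∀ K'', Clq G K'' → p K'' → K'' ⊆ W → K''.card ≤ K'.card := by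
  classical
  obtain ⟨K', h1, h2⟩ := Finset.exists_max_image (W.powerset.filter fun K => Clq G K ∧ p K)
    Finset.card ⟨K, by simp [h, hp, hK]⟩
  simp only [Finset.mem_filter, Finset.mem_powerset] at h1 h2
  exact ⟨K', h1.2.1, h1.2.2, h1.1, h2 K ⟨hK, h, hp⟩, fun K'' a b c => h2 K'' ⟨c, a, b⟩⟩

namespace Critical

variable (C : Critical G W x y k)

include C

lemma false_of_clq_frame (F : Frame G W x y H U b) (hr : r ∈ U) (hbr : G.Adj b r)
    (hH : Clq G H) (h3 : 3 ≤ H.card) (hmax : ∀ u ∈ U, u ≠ b → u ≠ y → ∃ a ∈ H, ¬ G.Adj a u) :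
    False := by
  obtain ⟨P, c, M⟩ := F.exists_minPiece hr hbr
  have hx := F.x_mem
  obtain ⟨e, he, hex⟩ := Finset.exists_mem_ne (by omega : 1 < H.card) x
  have hPU := M.subset
  have hyP := F.y_notMem_piece M.toPiece
  obtain ⟨u, hu, f, hf, hfx, hfu⟩ := C.exists_touch F M he hex
  refine C.not_touch F M (E := H.erase x) (e := e) (l := H.card - 2) (Finset.erase_subset _ _)
    (by grind) hex ⟨1, 1, .inl rfl, ?_⟩ ?_ u hu f (by grind) hfu
  · intro e he i hi
    have := hH.path hx (Finset.mem_of_mem_erase he) (Finset.ne_of_mem_erase he)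
      (n := i) (by omega)
    convert this using 1
    ring
  · intro u hu
    by_cases h : ∃ e ∈ H.erase x, G.Adj e u
    · obtain ⟨a, ha, hau⟩ := hmax u (by grind) (by grind) (by grind)
      have := nbr_card_lt ha fun h => hau h.symm
      exact .inr ⟨h, by omega⟩
    · left
      have : (nbr G H u).card ≤ ({x} : Finset V).card := by
        refine nbr_card_le_of_subset fun v hv huv => ?_
        by_contra hvx
        exact h ⟨v, by grind, huv.symm⟩
      simp only [Finset.card_singleton] at this
      omega

lemma notMem_of_clq (hK : Clq G K) (hx : x ∈ K) : y ∉ K :=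
  fun hy => C.not_adj (hK x hx y hy C.ne)

lemma nbr_mem_clq (hK : Clq G K) (hKW : K ⊆ W) (hx : x ∈ K) (h3 : 3 ≤ K.card)
    (hmax : ∀ K', Clq G K' → x ∈ K' → K' ⊆ W → K'.card ≤ K.card) (hr : r ∈ W)
    (hyr : G.Adj y r) : r ∈ K := by
  by_contra hrK
  refine C.false_of_clq_frame (.of_right hKW hx C.y_mem (C.notMem_of_clq hK hx)) (r := r)
    (by grind) hyr hK h3 ?_
  intro u hu _ _
  by_contra! hcon
  have := hmax (insert u K) (hK.insert hcon) (by grind) (by grind)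
  rw [Finset.card_insert_of_notMem (by grind)] at this
  omega

lemma card_clq_le (hK : Clq G K) (hKW : K ⊆ W) (hx : x ∈ K) : K.card ≤ 3 := by
  obtain ⟨K', hK', hx', hKW', hle, hmax⟩ := exists_max_clq hK (fun K => x ∈ K) hx hKW
  by_contra hcon
  obtain ⟨b, hb, hyb, hbx⟩ := C.symm.exists_adj
  have hbK := C.nbr_mem_clq hK' hKW' hx' (by omega) hmax hb hyb
  have hyK := C.notMem_of_clq hK' hx'
  have hcard : (K'.erase b).card = K'.card - 1 := Finset.card_erase_of_mem hbK
  by_cases hk : K'.card ≤ k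
  · obtain ⟨r, hr, hbr, hrS⟩ := C.exists_adj_notMem (S := insert y (K'.erase b)) hb hbx hyb.ne'
      ((Finset.card_insert_le _ _).trans (by omega))
    have hbr' := hbr.ne
    refine C.false_of_clq_frame (H := K'.erase b) (Frame.of_adj (b := b) (by grind) (by grind)
      (by grind) hb (by simp) hyb ?_) (r := r) (by grind) hbr (hK'.mono (Finset.erase_subset _ _))
      (by omega) ?_
    · intro w hw hyw
      have := C.nbr_mem_clq hK' hKW' hx' (by omega) hmax hw hyw
      grind
    · intro u hu hub huy
      by_contra! hcon
      have hcl := (hK'.mono (Finset.erase_subset b _)).insert hcon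
      have hcard' : (insert u (K'.erase b)).card = K'.card := by
        rw [Finset.card_insert_of_notMem (by grind)]
        omega
      have := C.nbr_mem_clq hcl (by grind) (by grind) (by omega)
        (fun K'' h1 h2 h3 => hcard' ▸ hmax K'' h1 h2 h3) hb hyb
      grind
  · refine C.not_adm (Adm.then_reach (A := K') (B := {b, y}) (v := b)
      ⟨1, 1, .inl rfl, fun i hi => ?_⟩ ⟨1, .adj hyb.symm⟩ (by grind) (by grind) ?_)
    · have := hK'.path hx' hbK hbx (n := i) (by omega)
      change PathIn _ _ _ _ _
      convert this using 1
      ring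
    · have := C.y_mem
      grind

lemma false_of_two_nbrs {a : V} (ha : a ∈ W) (hb : b ∈ W) (hab : a ≠ b) (hxa : G.Adj x a)
    (hyb : G.Adj y b) (hx : ∀ w ∈ W, G.Adj x w → w = a ∨ w = b)
    (hy : ∀ w ∈ W, G.Adj y w → w = a ∨ w = b) : False := by
  have hxW := C.x_mem
  have hyW := C.y_mem
  have hxy := C.ne
  have hay : a ≠ y := by rintro rfl; exact C.not_adj hxa
  have hbx : b ≠ x := by rintro rfl; exact C.not_adj hyb.symm
  have hxa' := hxa.ne
  have hyb' := hyb.ne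
  obtain ⟨u, hu, hau, huS⟩ := C.exists_adj_notMem (S := {x, y, b}) ha hxa.ne' hay
    (Finset.card_le_three.trans C.three_le)
  have hau' := hau.ne
  have h1 : Adm G ((W \ {x, y, a, b}) ∪ {a, b}) a b k := by
    refine C.adm_sub (v := u) (w := x) (by grind) (by grind) (by grind) (by grind) ha hb (by grind)
      (by grind) hab ?_ hxW (by grind) (by grind) (by grind)
    intro v hv w hw hvw
    have h2 := hx v (by grind)
    have h3 := hy v (by grind)
    have h4 := hvw.symm
    grind
  have h2 : Adm G (insert x ((W \ {x, y, a, b}) ∪ {a, b})) x b k :=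
    ReachIn.then_adm (B := {x, a}) ⟨1, .adj hxa⟩ h1 (by grind) (by grind) (by grind)
  exact C.not_adm (h2.then_reach (B := {b, y}) ⟨1, .adj hyb.symm⟩ (by grind) (by grind) (by grind))

lemma not_triangle (hu : u ∈ W) (hv : v ∈ W) (hxu : G.Adj x u) (hxv : G.Adj x v) :
    ¬ G.Adj u v := by
  intro huv
  have hxW := C.x_mem
  have hK : Clq G {x, u, v} := by
    intro a ha b hb hab
    have h1 := hxu.symm
    have h2 := hxv.symm
    have h3 := huv.symm
    grind
  have hcard : ({x, u, v} : Finset V).card = 3 :=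
    Finset.card_eq_three.2 ⟨x, u, v, hxu.ne, hxv.ne, huv.ne, rfl⟩
  have hy : ∀ w ∈ W, G.Adj y w → w = u ∨ w = v := by
    intro w hw hyw
    have := C.nbr_mem_clq hK (by grind) (by grind) (by omega)
      (fun K' h1 h2 h3 => hcard ▸ C.card_clq_le h1 h3 h2) hw hyw
    have hwx : w ≠ x := by rintro rfl; exact C.not_adj hyw.symm
    grind
  have hyu : G.Adj y u := by
    by_contra h
    exact C.false_of_pendant (b := v) fun w hw hyw => (hy w hw hyw).resolve_left
      (by rintro rfl; exact h hyw)
  have hyv : G.Adj y v := by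
    by_contra h
    exact C.false_of_pendant (b := u) fun w hw hyw => (hy w hw hyw).resolve_right
      (by rintro rfl; exact h hyw)
  have hyW := C.y_mem
  have hK' : Clq G {y, u, v} := by
    intro a ha b hb hab
    have h1 := hyu.symm
    have h2 := hyv.symm
    have h3 := huv.symm
    grind
  have hcard' : ({y, u, v} : Finset V).card = 3 :=
    Finset.card_eq_three.2 ⟨y, u, v, hyu.ne, hyv.ne, huv.ne, rfl⟩
  refine C.false_of_two_nbrs hu hv huv.ne hxu hyv ?_ hy
  intro w hw hxw
  have := C.symm.nbr_mem_clq hK' (by grind) (by grind) (by omega)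
    (fun K' h1 h2 h3 => hcard' ▸ C.symm.card_clq_le h1 h3 h2) hw hxw
  have hwx : w ≠ y := by rintro rfl; exact C.not_adj hxw
  grind

end Critical

end CliqueCores

section WedgeCores

variable {V : Type*} [DecidableEq V]
variable {G G' : SimpleGraph V} {W A B Z E H K P Q S U : Finset V}
  {b c d e p q r s t t' u v w x y z : V} {k l m n N : ℕ}

/-- `Q` is a clique in the common neighbourhood of two neighbours `t`, `t'` of `x`. -/
structure Wedge (G : SimpleGraph V) (W : Finset V) (x y t t' : V) (Q : Finset V) : Prop where
  t_mem : t ∈ W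
  t'_mem : t' ∈ W
  ne : t ≠ t'
  adj : G.Adj x t
  adj' : G.Adj x t'
  clq : Clq G Q
  subset : ∀ q ∈ Q, q ∈ W ∧ q ≠ x ∧ q ≠ y ∧ G.Adj t q ∧ G.Adj t' q

namespace Wedge

lemma swap (h : Wedge G W x y t t' Q) : Wedge G W x y t' t Q :=
  ⟨h.t'_mem, h.t_mem, h.ne.symm, h.adj', h.adj, h.clq, fun q hq => by
    have := h.subset q hq
    tauto⟩

lemma path (h : Wedge G W x y t t' Q) (hq : q ∈ Q) (h2 : 2 ≤ Q.card) (hn : n < Q.card + 1) :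
    PathIn G ({x, t, t'} ∪ Q) x q (2 + n * 1) := by
  have hne := h.ne
  have hsub := h.subset
  have hxt := h.adj.ne
  have hxt' := h.adj'.ne
  have htQ : t ∉ Q := fun h' => (hsub t h').2.2.2.1.ne rfl
  have htQ' : t' ∉ Q := fun h' => (hsub t' h').2.2.2.2.ne rfl
  have hxQ : x ∉ Q := fun h' => (hsub x h').2.1 rfl
  rcases Nat.lt_or_ge n Q.card with hlt | hge
  · have hcl : Clq G (insert t Q) := h.clq.insert fun a ha => (hsub a ha).2.2.2.1.symm
    have hp := hcl.path (x := t) (e := q) (n := n) (by simp) (by simp [hq]) (by grind)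
      (by rw [Finset.card_insert_of_notMem htQ]; omega)
    have := PathIn.cons (A := {x, t, t'} ∪ Q) (by simp) h.adj (hp.mono (by grind))
    convert this using 1
    ring
  · obtain ⟨q', hq', hqq⟩ := Finset.exists_mem_ne (by omega : 1 < Q.card) q
    have hcl : Clq G (insert t' (Q.erase q')) :=
      (h.clq.mono (Finset.erase_subset _ _)).insert fun a ha =>
        (hsub a (Finset.mem_of_mem_erase ha)).2.2.2.2.symm
    have hp := hcl.path (x := t') (e := q) (n := n - 2) (by simp) (by grind) (by grind)
      (by rw [Finset.card_insert_of_notMem (by grind), Finset.card_erase_of_mem hq']; omega)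
    have h3 := PathIn.cons (A := insert q' (insert t' (Q.erase q'))) (by simp)
      (hsub q' hq').2.2.2.2.symm (hp.mono (by grind))
    have h4 := PathIn.cons (A := insert t (insert q' (insert t' (Q.erase q')))) (by simp)
      (hsub q' hq').2.2.2.1 (h3.mono (by grind))
    have h5 := PathIn.cons (A := {x, t, t'} ∪ Q) (by simp) h.adj (h4.mono (by grind))
    convert h5 using 1
    omega

lemma path_left (h : Wedge G W x y t t' Q) (h2 : 2 ≤ Q.card) (hn : n < 2) :
    PathIn G ({x, t, t'} ∪ Q) x t (3 + n * 1) := by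
  obtain ⟨q, hq, q', hq', hqq⟩ := Finset.one_lt_card.1 (by omega : 1 < Q.card)
  have hne := h.ne
  have hsub := h.subset
  have hxt := h.adj.ne
  have hxt' := h.adj'.ne
  have htQ : t ∉ Q := fun h' => (hsub t h').2.2.2.1.ne rfl
  have htQ' : t' ∉ Q := fun h' => (hsub t' h').2.2.2.2.ne rfl
  have hxQ : x ∉ Q := fun h' => (hsub x h').2.1 rfl
  have h1 := PathIn.adj (hsub q hq).2.2.2.1.symm
  have h2 := PathIn.adj (hsub q' hq').2.2.2.1.symm
  have h3 := PathIn.cons (A := insert q {q', t}) (by simp) (h.clq q hq q' hq' hqq)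
    (h2.mono (by grind))
  have h4 : ∃ B : Finset V, B ⊆ insert t Q ∧ PathIn G B q t (n + 1) := by
    interval_cases n
    · exact ⟨_, by grind, h1⟩
    · exact ⟨_, by grind, h3⟩
  obtain ⟨B, hB, h4⟩ := h4
  have h5 := PathIn.cons (A := insert t' B) (by simp) (hsub q hq).2.2.2.2 (h4.mono (by grind))
  have h6 := PathIn.cons (A := {x, t, t'} ∪ Q) (by simp) h.adj' (h5.mono (by grind))
  convert h6 using 1
  ring

end Wedge

namespace Critical

variable (C : Critical G W x y k)

include C

lemma nbr_mem_wedge (T : Wedge G W x y t t' Q) (h2 : 2 ≤ Q.card)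
    (hmax : ∀ Q', Wedge G W x y t t' Q' → Q'.card ≤ Q.card) (hr : r ∈ W) (hyr : G.Adj y r) :
    r ∈ {x, t, t'} ∪ Q := by
  by_contra hrH
  have hxW := C.x_mem
  have hyW := C.y_mem
  have hxy := C.ne
  have hsub := T.subset
  have ht := T.t_mem
  have ht' := T.t'_mem
  have hxt := T.adj
  have hxt' := T.adj'
  have hne := T.ne
  have hxy' := C.not_adj
  have hxu : ∀ u ∈ W, G.Adj x u → ¬ G.Adj t u ∧ ¬ G.Adj t' u ∧ u ∉ Q := by
    intro u hu hxu
    exact ⟨C.not_triangle ht hu hxt hxu, C.not_triangle ht' hu hxt' hxu, fun h =>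
      C.not_triangle ht hu hxt hxu (hsub u h).2.2.2.1⟩
  have F : Frame G W x y ({x, t, t'} ∪ Q) (W \ ({x, t, t'} ∪ Q)) y :=
    .of_right (by grind) (by grind) hyW (by grind)
  obtain ⟨P, c, M⟩ := F.exists_minPiece (r := r) (by grind) hyr
  have hPU := M.subset
  obtain ⟨q, hq⟩ := Finset.card_pos.1 (by omega : 0 < Q.card)
  have hnQ : ∀ u ∈ P, ∀ e ∈ Q, ¬ G.Adj e u := by
    refine C.not_touch F M (E := Q) (e := q) (l := Q.card) (by grind) hq (by grind)
      ⟨2, 1, .inl rfl, fun e he i hi => T.path he h2 hi⟩ fun u hu => ?_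
    have huU := hPU hu
    by_cases huQ : ∃ e ∈ Q, G.Adj e u
    · refine .inr ⟨huQ, ?_⟩
      by_cases hux : G.Adj x u
      · have := hxu u (by grind) hux
        refine (nbr_card_le_of_subset (S := insert x Q) fun v hv huv => ?_).trans
          (Finset.card_insert_le _ _)
        have := huv.symm
        grind
      · have hex : ∃ v ∈ insert t (insert t' Q), ¬ G.Adj u v := by
          by_contra! hcon
          have hT' : Wedge G W x y t t' (insert u Q) := by
            refine ⟨ht, ht', hne, hxt, hxt', T.clq.insert fun a ha => (hcon a (by grind)).symm,
              fun v hv => ?_⟩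
            rcases Finset.mem_insert.1 hv with rfl | hv
            · exact ⟨by grind, by grind, by grind, (hcon t (by grind)).symm,
                (hcon t' (by grind)).symm⟩
            · exact hsub v hv
          have := hmax _ hT'
          rw [Finset.card_insert_of_notMem (by grind)] at this
          omega
        obtain ⟨v, hv, huv⟩ := hex
        have h3 : (nbr G ({x, t, t'} ∪ Q) u).card ≤ ((insert t (insert t' Q)).erase v).card := by
          refine nbr_card_le_of_subset fun w hw huw => ?_
          have := huw.symm
          grind
        have h4 := Finset.card_insert_le t (insert t' Q)
        have h5 := Finset.card_insert_le t' Q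
        rw [Finset.card_erase_of_mem hv] at h3
        omega
    · left
      push Not at huQ
      by_cases hux : G.Adj x u
      · have := hxu u (by grind) hux
        have h3 : (nbr G ({x, t, t'} ∪ Q) u).card ≤ ({x} : Finset V).card := by
          refine nbr_card_le_of_subset fun w hw huw => ?_
          have := huw.symm
          grind
        simp only [Finset.card_singleton] at h3
        omega
      · have h3 : (nbr G ({x, t, t'} ∪ Q) u).card ≤ ({t, t'} : Finset V).card := by
          refine nbr_card_le_of_subset fun w hw huw => ?_
          have := huw.symm
          grind
        exact h3.trans (Finset.card_le_two.trans h2)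
  have hnT : ∀ u ∈ P, ∀ e ∈ ({t, t'} : Finset V), ¬ G.Adj e u := by
    refine C.not_touch F M (e := t) (l := 1) (by grind) (by simp) hxt.ne'
      ⟨3, 1, .inl rfl, fun e he i hi => ?_⟩ fun u hu => ?_
    · rcases Finset.mem_insert.1 he with rfl | he
      · exact T.path_left h2 hi
      · obtain rfl := Finset.mem_singleton.1 he
        exact (T.swap.path_left h2 hi).mono (by grind)
    have huU := hPU hu
    have h3 := hnQ u hu
    by_cases hux : G.Adj x u
    · left
      have := hxu u (by grind) hux
      have h4 : (nbr G ({x, t, t'} ∪ Q) u).card ≤ ({x} : Finset V).card := by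
        refine nbr_card_le_of_subset fun w hw huw => ?_
        have := huw.symm
        grind
      simpa using h4
    by_cases huT : ∃ e ∈ ({t, t'} : Finset V), G.Adj e u
    · refine .inr ⟨huT, ?_⟩
      have h4 : (nbr G ({x, t, t'} ∪ Q) u).card ≤ ({t, t'} : Finset V).card := by
        refine nbr_card_le_of_subset fun w hw huw => ?_
        have := huw.symm
        grind
      exact h4.trans Finset.card_le_two
    · left
      refine (nbr_card_le_of_subset (S := ∅) fun w hw huw => ?_).trans (by simp)
      have := huw.symm
      grind
  obtain ⟨u, hu, f, hf, hfx, hfu⟩ := C.exists_touch F M (e := t) (by grind) hxt.ne'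
  have h3 := hnQ u hu
  have h4 := hnT u hu
  grind

lemma not_wedge (T : Wedge G W x y t t' Q) (h2 : 2 ≤ Q.card) : False := by
  classical
  obtain ⟨Q, hclq, T, -, hle, hmax⟩ := exists_max_clq (W := W) T.clq (Wedge G W x y t t') T
    fun q hq => (T.subset q hq).1
  replace hmax : ∀ Q', Wedge G W x y t t' Q' → Q'.card ≤ Q.card := fun Q' h =>
    hmax Q' h.clq h fun q hq => (h.subset q hq).1
  replace h2 := h2.trans hle
  have hsub := T.subset
  have hH := fun r hr hyr => C.nbr_mem_wedge T h2 hmax (r := r) hr hyr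
  have hnot : ∀ q ∈ Q, ¬ G.Adj y q := by
    intro q hq hyq
    refine C.false_of_pendant (b := q) fun w hw hyw => ?_
    by_contra hwq
    have h3 := hH w hw hyw
    have h4 : w ≠ x := by rintro rfl; exact C.not_adj hyw.symm
    have h5 := hsub q hq
    refine C.symm.not_triangle hw h5.1 hyw hyq ?_
    have h6 := T.clq w
    grind
  have hy : ∀ w ∈ W, G.Adj y w → w = t ∨ w = t' := by
    intro w hw hyw
    have h3 := hH w hw hyw
    have h4 : w ≠ x := by rintro rfl; exact C.not_adj hyw.symm
    have h5 := hnot w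
    grind
  have hyt : G.Adj y t := by
    by_contra h
    exact C.false_of_pendant (b := t') fun w hw hyw => (hy w hw hyw).resolve_left
      (by rintro rfl; exact h hyw)
  have hyt' : G.Adj y t' := by
    by_contra h
    exact C.false_of_pendant (b := t) fun w hw hyw => (hy w hw hyw).resolve_right
      (by rintro rfl; exact h hyw)
  have hflip : ∀ Q' x y, Wedge G W x y t t' Q' → G.Adj y t → G.Adj y t' →
      Wedge G W y x t t' Q' := by
    intro Q' x y T hyt hyt'
    refine ⟨T.t_mem, T.t'_mem, T.ne, hyt, hyt', T.clq, fun q hq => ?_⟩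
    have := T.subset q hq
    tauto
  refine C.false_of_two_nbrs T.t_mem T.t'_mem T.ne T.adj hyt' ?_ hy
  intro w hw hxw
  have h3 := C.symm.nbr_mem_wedge (hflip Q x y T hyt hyt') h2
    (fun Q' T' => hmax Q' (hflip Q' y x T' T.adj T.adj')) hw hxw
  have h4 : w ≠ y := by rintro rfl; exact C.not_adj hxw
  have h5 := C.not_triangle T.t_mem hw T.adj hxw
  have h6 := hsub w
  grind

end Critical

end WedgeCores

section BipartiteCores

variable {V : Type*} [DecidableEq V]
variable {G G' : SimpleGraph V} {W A B Z E H K P Q S T U : Finset V}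
  {a b c d e p q r s t t' t₁ t₂ u v w x y z : V} {k l m n N : ℕ}

lemma path_of_biclique (ha : ∀ t ∈ T, G.Adj a t) (haS : a ∉ S) (hST : ∀ s ∈ S, ∀ t ∈ T, G.Adj s t)
    (hn : n ≤ S.card) (hn' : n < T.card) (ht : t ∈ T) :
    PathIn G (insert a (S ∪ T)) a t (2 * n + 1) := by
  induction n generalizing a S T with
  | zero => exact (PathIn.adj (ha t ht)).mono (by grind)
  | succ n ih =>
    obtain ⟨t', ht', htt⟩ := Finset.exists_mem_ne (by omega : 1 < T.card) t
    obtain ⟨s, hs⟩ := Finset.card_pos.1 (by omega : 0 < S.card)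
    have h1 := ih (a := s) (S := S.erase s) (T := T.erase t')
      (fun t ht => hST s hs t (Finset.mem_of_mem_erase ht)) (by simp)
      (fun s hs t ht => hST s (Finset.mem_of_mem_erase hs) t (Finset.mem_of_mem_erase ht))
      (by rw [Finset.card_erase_of_mem hs]; omega) (by rw [Finset.card_erase_of_mem ht']; omega)
      (by grind)
    have haT : a ∉ T := fun h => (ha a h).ne rfl
    have ht'S : t' ∉ S := fun h => (hST t' h t' ht').ne rfl
    have hat := ha t' ht'
    have hst := (hST s hs t' ht').symm
    clear ih ha hST
    have h2 := PathIn.cons (A := insert t' (insert s (S.erase s ∪ T.erase t'))) (by simp)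
      hst (h1.mono (by grind))
    have h3 := PathIn.cons (A := insert a (S ∪ T)) (by simp) hat (h2.mono (by grind))
    convert h3 using 1
    ring

/-- `T` is a set of more than `|S|` common neighbours of `x` and the vertices of `S`. -/
structure Bip (G : SimpleGraph V) (W : Finset V) (x y : V) (S T : Finset V) : Prop where
  left : ∀ s ∈ S, s ∈ W ∧ s ≠ x ∧ s ≠ y
  right : ∀ t ∈ T, t ∈ W ∧ G.Adj x t ∧ ∀ s ∈ S, G.Adj s t
  lt : S.card < T.card

open Classical in
/-- The common neighbours of `x` and the vertices of `S`. -/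
noncomputable def common (G : SimpleGraph V) (W : Finset V) (x : V) (S : Finset V) : Finset V :=
  {w ∈ W | G.Adj x w ∧ ∀ s ∈ S, G.Adj s w}

lemma mem_common : w ∈ common G W x S ↔ w ∈ W ∧ G.Adj x w ∧ ∀ s ∈ S, G.Adj s w := by
  simp [common]

namespace Bip

lemma subset_common (h : Bip G W x y S T) : T ⊆ common G W x S :=
  fun t ht => mem_common.2 (h.right t ht)

lemma of_common (h : Bip G W x y S T) : Bip G W x y S (common G W x S) :=
  ⟨h.left, fun _ ht => mem_common.1 ht, h.lt.trans_le (Finset.card_le_card h.subset_common)⟩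

lemma insert_left (h : Bip G W x y S T) (hu : u ∈ W) (hux : u ≠ x) (huy : u ≠ y) (huS : u ∉ S)
    (hcard : S.card + 1 < (nbr G T u).card) : Bip G W x y (insert u S) (nbr G T u) := by
  refine ⟨fun s hs => ?_, fun t ht => ?_, by rwa [Finset.card_insert_of_notMem huS]⟩
  · rcases Finset.mem_insert.1 hs with rfl | hs
    · exact ⟨hu, hux, huy⟩
    · exact h.left s hs
  · rw [mem_nbr] at ht
    obtain ⟨h1, h2, h3⟩ := h.right t ht.1
    refine ⟨h1, h2, fun s hs => ?_⟩
    rcases Finset.mem_insert.1 hs with rfl | hs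
    · exact ht.2
    · exact h3 s hs

lemma path (h : Bip G W x y S T) (ht : t ∈ T) (hn : n < S.card + 1) :
    PathIn G (Insert.insert x (S ∪ T)) x t (1 + n * 2) := by
  have := path_of_biclique (a := x) (S := S) (T := T) (n := n) (fun t ht => (h.right t ht).2.1)
    (fun hx => (h.left x hx).2.1 rfl) (fun s hs t ht => (h.right t ht).2.2 s hs) (by omega)
    (by have := h.lt; omega) ht
  convert this using 1
  ring

lemma path' (h : Bip G W x y S T) (hs : s ∈ S) (hn : n < S.card) :
    PathIn G (Insert.insert x (S ∪ T)) x s (2 + n * 2) := by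
  have hlt := h.lt
  obtain ⟨t, ht⟩ := Finset.card_pos.1 (by omega : 0 < T.card)
  have hxS : x ∉ S := fun hx => (h.left x hx).2.1 rfl
  have hxT : x ∉ T := fun hx => (h.right x hx).2.1.ne rfl
  have h1 := path_of_biclique (a := t) (S := T.erase t) (T := S) (n := n)
    (fun s hs => ((h.right t ht).2.2 s hs).symm) (by simp)
    (fun u hu s hs => ((h.right u (Finset.mem_of_mem_erase hu)).2.2 s hs).symm)
    (by rw [Finset.card_erase_of_mem ht]; omega) hn hs
  have := PathIn.cons (A := Insert.insert x (S ∪ T)) (by simp) (h.right t ht).2.1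
    (h1.mono (by grind))
  convert this using 1
  ring

lemma card_nbr_le (D : Bip G W x y S T)
    (hmax : ∀ S' T', Bip G W x y S' T' → S'.card ≤ S.card) (hu : u ∈ W) (hux : u ≠ x) (huy : u ≠ y)
    (huS : u ∉ S) : (nbr G T u).card ≤ S.card + 1 := by
  by_contra! hcon
  have := hmax _ _ (D.insert_left hu hux huy huS hcon)
  rw [Finset.card_insert_of_notMem huS] at this
  omega

lemma subset (D : Bip G W x y S T) (hx : x ∈ W) : insert x (S ∪ T) ⊆ W := by
  intro v hv
  simp only [Finset.mem_insert, Finset.mem_union] at hv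
  rcases hv with rfl | hv | hv
  · exact hx
  · exact (D.left v hv).1
  · exact (D.right v hv).1

end Bip

/-- The configuration left over when a four-cycle `x t₁ s t₂` is used as a core. -/
structure Square (G : SimpleGraph V) (W : Finset V) (x y s t₁ t₂ : V) (P : Finset V)
    (c : V) : Prop where
  s_mem : s ∈ W
  s_ne_x : s ≠ x
  s_ne_y : s ≠ y
  t₁_mem : t₁ ∈ W
  t₂_mem : t₂ ∈ W
  ne : t₁ ≠ t₂
  adj₁ : G.Adj x t₁
  adj₂ : G.Adj x t₂
  adj₁' : G.Adj s t₁
  adj₂' : G.Adj s t₂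
  nonempty : P.Nonempty
  subset : P ⊆ W \ {x, y, s, t₁, t₂}
  c_mem : c ∈ W \ {x, s, t₁, t₂}
  c_notMem : c ∉ P
  closed : ∀ a ∈ P, ∀ w ∈ W, G.Adj a w → w ∈ P ∨ w = x ∨ w = s ∨ w = c
  reach : ∀ v ∈ P, ReachIn G (insert c P) v c
  reach_avoiding : ∀ d ∈ P, ∀ v ∈ P, v ≠ d → ReachIn G ((insert c P).erase d) v c
  to_y : ReachIn G (W \ (P ∪ {x, s, t₁, t₂})) c y

namespace Critical

variable (C : Critical G W x y k)

include C

lemma not_adj_of_common (ht : t ∈ W) (ht' : t' ∈ W) (hne : t ≠ t') (hxt : G.Adj x t)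
    (hxt' : G.Adj x t') (hp : p ∈ W) (hpy : p ≠ y) (hq : q ∈ W) (hqy : q ≠ y) (htp : G.Adj t p)
    (htq : G.Adj t q) (htp' : G.Adj t' p) (htq' : G.Adj t' q) : ¬ G.Adj p q := by
  intro hpq
  have hpq' := hpq.symm
  have hpx : p ≠ x := by
    rintro rfl
    exact C.not_triangle ht hq hxt hpq htq
  have hqx : q ≠ x := by
    rintro rfl
    exact C.not_triangle ht hp hxt hpq.symm htp
  refine C.not_wedge (Q := {p, q}) ⟨ht, ht', hne, hxt, hxt', ?_, ?_⟩ ?_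
  · intro a ha b hb hab
    grind
  · grind
  · rw [Finset.card_pair hpq.ne]

lemma bip_not_touch (D : Bip G W x y S T) (F : Frame G W x y (insert x (S ∪ T)) U b)
    (M : MinPiece G W (insert x (S ∪ T)) U b P c)
    (hfull : ∀ u ∈ U, u ≠ b → G.Adj x u → ∃ s ∈ S, ¬ G.Adj s u)
    (hmax : ∀ u ∈ U, u ≠ b → u ≠ x → u ≠ y → (nbr G T u).card ≤ S.card + 1) :
    ∀ u ∈ P, ∀ e ∈ T, ¬ G.Adj e u := by
  have hPU := M.subset
  have hyP := F.y_notMem_piece M.toPiece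
  have hxH := F.x_mem
  have hUW := F.U_subset
  have hHW := F.H_subset
  have hdisj := F.disj
  have hlt := D.lt
  have hleft := D.left
  have hright := D.right
  have hxS : x ∉ S := fun hx => (D.left x hx).2.1 rfl
  have hxT : x ∉ T := fun hx => (D.right x hx).2.1.ne rfl
  have hPd : ∀ u ∈ P, u ∈ W ∧ u ≠ x ∧ u ≠ y ∧ u ∉ S ∧ u ∉ T ∧ u ∈ U ∧ u ≠ b := by
    intro u hu
    have := hPU hu
    have := hdisj u
    grind
  obtain ⟨t₁, ht₁⟩ := Finset.card_pos.1 (by omega : 0 < T.card)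
  have hxT : ∀ u ∈ P, G.Adj x u → (∀ t ∈ T, ¬ G.Adj t u) ∧ (nbr G S u).card + 1 ≤ S.card := by
    intro u hu hxu
    obtain ⟨h1, h2, h3, h4, h5, h6, h7⟩ := hPd u hu
    refine ⟨fun t ht => C.not_triangle (hright t ht).1 h1 (hright t ht).2.1 hxu, ?_⟩
    obtain ⟨s, hs, hsu⟩ := hfull u h6 h7 hxu
    exact nbr_card_lt hs fun h => hsu h.symm
  refine C.not_touch F M (E := T) (e := t₁) (l := S.card) (by grind) ht₁ (by grind)
    ⟨1, 2, .inr rfl, fun e he i hi => D.path he hi⟩ fun u hu => ?_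
  obtain ⟨h1, h2, h3, h4, h5, h6, h7⟩ := hPd u hu
  by_cases hux : G.Adj x u
  · left
    obtain ⟨h8, h9⟩ := hxT u hu hux
    have h10 : (nbr G (insert x (S ∪ T)) u).card ≤ (insert x (nbr G S u)).card := by
      refine nbr_card_le_of_subset fun w hw huw => ?_
      have := huw.symm
      grind [mem_nbr]
    exact h10.trans ((Finset.card_insert_le _ _).trans h9)
  have h8 := hmax u h6 h7 h2 h3
  by_cases huT : ∃ e ∈ T, G.Adj e u
  · refine .inr ⟨huT, ?_⟩
    by_cases h2T : 1 < (nbr G T u).card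
    · obtain ⟨t, ht, t', ht', htt⟩ := Finset.one_lt_card.1 h2T
      rw [mem_nbr] at ht ht'
      have hnS : ∀ s ∈ S, ¬ G.Adj u s := fun s hs =>
        C.not_adj_of_common (hright t ht.1).1 (hright t' ht'.1).1 htt (hright t ht.1).2.1
          (hright t' ht'.1).2.1 h1 h3 (hleft s hs).1 (hleft s hs).2.2 ht.2.symm
          ((hright t ht.1).2.2 s hs).symm ht'.2.symm ((hright t' ht'.1).2.2 s hs).symm
      refine (nbr_card_le_of_subset fun w hw huw => ?_).trans h8
      have := huw.symm
      grind [mem_nbr]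
    · have h9 : (nbr G (insert x (S ∪ T)) u).card ≤ (S ∪ nbr G T u).card := by
        refine nbr_card_le_of_subset fun w hw huw => ?_
        have := huw.symm
        grind [mem_nbr]
      have := Finset.card_union_le S (nbr G T u)
      omega
  · left
    refine nbr_card_le_of_subset fun w hw huw => ?_
    have := huw.symm
    grind

lemma square_of_piece (D : Bip G W x y {s} T) (F : Frame G W x y (insert x ({s} ∪ T)) U b)
    (M : MinPiece G W (insert x ({s} ∪ T)) U b P c)
    (hnT : ∀ u ∈ P, ∀ e ∈ T, ¬ G.Adj e u) :
    ∃ t₁ t₂, Square G W x y s t₁ t₂ P c := by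
  have hlt := D.lt
  rw [Finset.card_singleton] at hlt
  obtain ⟨t₁, ht₁, t₂, ht₂, hne⟩ := Finset.one_lt_card.1 hlt
  have hs := D.left s (by simp)
  have h₁ := D.right t₁ ht₁
  have h₂ := D.right t₂ ht₂
  have hst₁ := h₁.2.2 s (by simp)
  have hst₂ := h₂.2.2 s (by simp)
  have hc := M.c_mem
  have hcP := M.c_notMem
  have hPU := M.subset
  have hto := F.reach_y M.toPiece
  have hyP := F.y_notMem_piece M.toPiece
  have hUW := F.U_subset
  have hyW := C.y_mem
  have hyH := F.y_notMem
  have hxy := C.ne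
  have hH : ({x, s, t₁, t₂} : Finset V) ⊆ insert x ({s} ∪ T) := by
    intro v
    simp only [Finset.mem_insert, Finset.mem_singleton, Finset.mem_union]
    rintro (rfl | rfl | rfl | rfl) <;> simp [ht₁, ht₂]
  have hUH : ∀ u ∈ U, u ∉ ({x, s, t₁, t₂} : Finset V) := fun u hu h => F.disj u hu (hH h)
  have hyH' : y ∉ ({x, s, t₁, t₂} : Finset V) := fun h => hyH (hH h)
  refine ⟨t₁, t₂, hs.1, hs.2.1, hs.2.2, h₁.1, h₂.1, hne, h₁.2.1, h₂.2.1, hst₁, hst₂, M.nonempty,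
    ?_, ?_, hcP, ?_, M.reach, fun d hd v hv h => M.reach_avoiding hd hv h, ?_⟩
  · intro u hu
    have huU := Finset.mem_of_mem_erase (hPU hu)
    have := hUH u huU
    have : u ≠ y := by rintro rfl; exact hyP hu
    simp only [Finset.mem_sdiff, Finset.mem_insert, Finset.mem_singleton, not_or] at *
    exact ⟨hUW huU, by tauto⟩
  · exact Finset.mem_sdiff.2 ⟨hUW hc, hUH c hc⟩
  · intro a ha w hw haw
    have h1 := M.closed a ha w hw haw
    have h2 := hnT a ha w
    have h3 := haw.symm
    simp only [Finset.mem_insert, Finset.mem_singleton, Finset.mem_union] at h1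
    tauto
  · refine hto.mono fun v hv => ?_
    rw [Finset.mem_insert, Finset.mem_sdiff] at hv
    rw [Finset.mem_sdiff, Finset.mem_union, not_or]
    rcases hv with rfl | hv
    · exact ⟨hyW, hyP, hyH'⟩
    · exact ⟨hUW hv.1, hv.2, hUH v hv.1⟩

end Critical

end BipartiteCores

section SquareCores

variable {V : Type*} [DecidableEq V]
variable {G G' : SimpleGraph V} {W A B Z E H K P Q S T U : Finset V}
  {a b c d d' e p q r s t t' t₁ t₂ u v w x y z : V} {k l m n N : ℕ}

lemma subset_bad (hA : A ⊆ W) (hx : x ∉ A) (hy : y ∉ A) (hd : d ∉ A)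
    (hN : ∀ a ∈ A, ∀ w ∈ W, G.Adj a w → w ∈ A ∨ w = d) : A ⊆ bad G W x y d := by
  intro v hv
  refine mem_bad.2 ⟨hA hv, by grind, by grind, by grind, ?_⟩
  rintro (h | h)
  · obtain ⟨b, hb, w, hw, hwA, hbw, -⟩ := h.exists_exit hv hx
    have := hN b hb w
    grind
  · obtain ⟨b, hb, w, hw, hwA, hbw, -⟩ := h.exists_exit hv hy
    have := hN b hb w
    grind

lemma bad_subset : bad G W x y d ⊆ W := fun _ h => (mem_bad.1 h).1

lemma left_notMem_bad : x ∉ bad G W x y d := fun h => (mem_bad.1 h).2.1 rfl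

lemma right_notMem_bad : y ∉ bad G W x y d := fun h => (mem_bad.1 h).2.2.1 rfl

lemma self_notMem_bad : d ∉ bad G W x y d := fun h => (mem_bad.1 h).2.2.2.1 rfl

lemma exists_max_bad (G : SimpleGraph V) (W : Finset V) (x y : V) :
    ∃ d, ∀ d', (bad G W x y d').card ≤ (bad G W x y d).card := by
  by_contra! h
  have : ∀ n, ∃ d, n ≤ (bad G W x y d).card := by
    intro n
    induction n with
    | zero => exact ⟨x, Nat.zero_le _⟩
    | succ n ih =>
      obtain ⟨d, hd⟩ := ih
      obtain ⟨d', hd'⟩ := h d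
      exact ⟨d', by omega⟩
  obtain ⟨d, hd⟩ := this (W.card + 1)
  have := Finset.card_le_card (bad_subset (G := G) (W := W) (x := x) (y := y) (d := d))
  omega

lemma Rooted.of_forall (hx : x ∈ W) (hy : y ∈ W) (hxy : x ≠ y)
    (h : ∀ (A : Finset V) (d v : V), A ⊆ W → x ∉ A → y ∉ A → d ∉ A → v ∈ A →
      (∀ a ∈ A, ∀ w ∈ W, G.Adj a w → w ∈ A ∨ w = d) → False) : Rooted G W x y := by
  refine .of_bad hx hy hxy fun d => ?_
  by_contra hne
  obtain ⟨v, hv⟩ := Finset.nonempty_iff_ne_empty.2 hne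
  exact h _ d v bad_subset left_notMem_bad right_notMem_bad self_notMem_bad hv
    fun a ha w hw haw => bad_closed hxy ha hw haw

/-- The part of `P` which cannot reach a neighbour of `p` inside `P`. -/
lemma exists_untouched (hv : v ∈ P) (hcon : ¬ ∃ u ∈ P, G.Adj p u ∧ ReachIn G P v u) :
    ∃ A ⊆ P, v ∈ A ∧ (∀ a ∈ A, ¬ G.Adj p a) ∧ ∀ a ∈ A, ∀ w ∈ P, G.Adj a w → w ∈ A := by
  classical
  refine ⟨P.filter fun v => ¬ ∃ u ∈ P, G.Adj p u ∧ ReachIn G P v u, Finset.filter_subset _ _,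
    Finset.mem_filter.2 ⟨hv, hcon⟩, fun a ha hpa => ?_, fun a ha w hw haw => ?_⟩
  · rw [Finset.mem_filter] at ha
    exact ha.2 ⟨a, ha.1, hpa, .refl ha.1⟩
  · rw [Finset.mem_filter] at ha ⊢
    refine ⟨hw, ?_⟩
    rintro ⟨u, hu, hpu, hr⟩
    exact ha.2 ⟨u, hu, hpu, .head ha.1 haw hr⟩

namespace Critical

variable (C : Critical G W x y k)

include C

lemma adm_pred (h : Rooted G A p q) (hA : A ⊆ W) (hw : w ∈ W) (hwA : w ∉ A) (hv : v ∈ A)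
    (hvp : v ≠ p) (hvq : v ≠ q)
    (hN : ∀ u ∈ A, u ≠ p → u ≠ q → u ≠ x ∧ u ≠ y ∧
      ∃ z, ∀ w ∈ W, G.Adj u w → w ∈ A ∨ w = z) : Adm G A p q (k - 1) := by
  refine C.below G A p q (k - 1) (card_lt_of_mem hA hw hwA) h ⟨v, hv, hvp, hvq⟩ ?_
  intro u hu hup huq
  obtain ⟨hux, huy, z, hz⟩ := hN u hu hup huq
  have h1 := C.deg u (hA hu) hux huy
  have h2 := nbr_card_le_add (G := G) (W := W) (v := u) (A := A) (B := {z})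
    fun w hw huw => by simpa using hz w hw huw
  rw [Finset.card_singleton] at h2
  have := C.three_le
  omega

lemma adm_piece (hP : P.Nonempty) (hPW : P ⊆ W) (hx : x ∉ P) (hy : y ∉ P) (hp : p ∈ W)
    (hpP : p ∉ P) (hc : c ∈ W) (hcP : c ∉ P) (hpc : p ≠ c) (hq : q ∈ W) (hqP : q ∉ P)
    (hqp : q ≠ p) (hqc : q ≠ c)
    (hN : ∀ a ∈ P, ∀ w ∈ W, G.Adj a w → w ∈ P ∨ w = p ∨ w = q ∨ w = c)
    (h₁ : ∀ v ∈ P, ReachIn G (insert c P) v c)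
    (h₂ : ∀ v ∈ P, ∃ u ∈ P, G.Adj p u ∧ ReachIn G P v u)
    (h₃ : ∀ d ∈ P, ∀ v ∈ P, v ≠ d → ReachIn G ((insert c P).erase d) v c) :
    Adm G (P ∪ {p, c}) p c (k - 1) := by
  obtain ⟨v, hv⟩ := hP
  refine C.adm_pred (w := q) (v := v) ⟨by simp, by simp, hpc, fun d v hv hvp hvc hvd => ?_⟩
    (by grind) hq (by grind) (by grind) (by grind) (by grind) fun u hu hup huc => ?_
  · have hvP : v ∈ P := by simpa [hvp, hvc] using hv
    by_cases hdP : d ∈ P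
    · exact .inr ((h₃ d hdP v hvP hvd).mono (by grind))
    by_cases hdc : d = c
    · obtain ⟨u, hu, hpu, hr⟩ := h₂ v hvP
      exact .inl ((hr.mono (by grind)).tail hpu.symm (by grind))
    · exact .inr ((h₁ v hvP).mono (by grind))
  · have huP : u ∈ P := by simpa [hup, huc] using hu
    refine ⟨by grind, by grind, q, fun w hw huw => ?_⟩
    have := hN u huP w hw huw
    grind

end Critical

namespace Square

variable (C : Critical G W x y k) (D : Square G W x y s t₁ t₂ P c)

include D

lemma mem_piece (hu : u ∈ P) : u ∈ W ∧ u ≠ x ∧ u ≠ y ∧ u ≠ s ∧ u ≠ t₁ ∧ u ≠ t₂ := by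
  have := D.subset hu
  simpa using this

lemma c_spec : c ∈ W ∧ c ≠ x ∧ c ≠ s ∧ c ≠ t₁ ∧ c ≠ t₂ := by
  have := D.c_mem
  simpa using this

lemma x_notMem : x ∉ P := fun h => (D.mem_piece h).2.1 rfl

lemma y_notMem : y ∉ P := fun h => (D.mem_piece h).2.2.1 rfl

lemma s_notMem : s ∉ P := fun h => (D.mem_piece h).2.2.2.1 rfl

lemma not_adj_piece (hu : u ∈ W) (huP : u ∉ P) (hux : u ≠ x) (hus : u ≠ s) (huc : u ≠ c)
    (hw : w ∈ P) : ¬ G.Adj u w := by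
  intro h
  have := D.closed w hw u hu h.symm
  tauto

include C

lemma touch_x (hv : v ∈ P) : ∃ u ∈ P, G.Adj x u ∧ ReachIn G P v u := by
  by_contra hcon
  obtain ⟨A, hAP, hvA, hpA, hcl⟩ := exists_untouched hv hcon
  have hxW := C.x_mem
  have hyW := C.y_mem
  have hcs := D.c_spec
  have hcP := D.c_notMem
  have hxP := D.x_notMem
  have hyP := D.y_notMem
  have hsP := D.s_notMem
  have hsx := D.s_ne_x
  have hPW : P ⊆ W := fun u hu => (D.mem_piece hu).1
  have ht₁P : t₁ ∉ P := fun h => (D.mem_piece h).2.2.2.2.1 rfl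
  have h1 := C.adm_sub (A := A) (p := s) (q := c) (w := x) (v := v) (by grind) (by grind)
    (by grind) hvA D.s_mem hcs.1 (by grind) (by grind) (by grind) (fun a ha w hw haw => by
      have h1 := D.closed a (hAP ha) w hw haw
      have h2 := hcl a ha w
      have h3 := hpA a ha
      have h4 := haw.symm
      grind) hxW (by grind) (by grind) (by grind)
  have hxt := D.adj₁.ne
  have hst := D.adj₁'.ne
  have ht₁W := D.t₁_mem
  have hsW := D.s_mem
  have h2 : ReachIn G {x, t₁, s} x s :=
    .head (by simp) D.adj₁ (.head (by simp) D.adj₁'.symm (.refl (by simp)))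
  have h3 : Adm G (A ∪ {x, t₁, s, c}) x c k :=
    h2.then_adm h1 (by grind) (by grind) (by grind)
  exact C.not_adm (h3.then_reach D.to_y (by grind) (by grind) (by grind))

lemma touch_s (hv : v ∈ P) : ∃ u ∈ P, G.Adj s u ∧ ReachIn G P v u := by
  by_contra hcon
  obtain ⟨A, hAP, hvA, hpA, hcl⟩ := exists_untouched hv hcon
  have hcs := D.c_spec
  have hcP := D.c_notMem
  have hxP := D.x_notMem
  have hyP := D.y_notMem
  have hsP := D.s_notMem
  have hsx := D.s_ne_x
  have hPW : P ⊆ W := fun u hu => (D.mem_piece hu).1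
  refine C.false_of_sub (A := A) (q := c) (w := s) (v := v) (by grind) (by grind)
    (by grind) hvA hcs.1 (by grind) hcs.2.1 (fun a ha w hw haw => ?_) D.s_mem (by grind)
    (by grind) (by grind)
  have h1 := D.closed a (hAP ha) w hw haw
  have h2 := hcl a ha w
  have h3 := hpA a ha
  have h4 := haw.symm
  grind

lemma adm_x : Adm G (P ∪ {x, c}) x c (k - 1) :=
  C.adm_piece (q := s) D.nonempty (fun _ hu => (D.mem_piece hu).1) D.x_notMem D.y_notMem C.x_mem
    D.x_notMem D.c_spec.1 D.c_notMem D.c_spec.2.1.symm D.s_mem D.s_notMem D.s_ne_x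
    D.c_spec.2.2.1.symm D.closed D.reach (fun _ hv => D.touch_x C hv) D.reach_avoiding

lemma adm_s : Adm G (P ∪ {s, c}) s c (k - 1) :=
  C.adm_piece (q := x) D.nonempty (fun _ hu => (D.mem_piece hu).1) D.x_notMem D.y_notMem D.s_mem
    D.s_notMem D.c_spec.1 D.c_notMem D.c_spec.2.2.1.symm C.x_mem D.x_notMem D.s_ne_x.symm
    D.c_spec.2.1.symm (fun a ha w hw haw => by have := D.closed a ha w hw haw; tauto)
    D.reach (fun _ hv => D.touch_s C hv) D.reach_avoiding

lemma c_ne_y : c ≠ y := by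
  rintro rfl
  have hxW := C.x_mem
  have hyW := C.y_mem
  have hcs := D.c_spec
  have hyP := D.y_notMem
  have hxP := D.x_notMem
  have hsP := D.s_notMem
  have hsx := D.s_ne_x
  have hsW := D.s_mem
  have ht₁W := D.t₁_mem
  have hxt := D.adj₁.ne
  have hst := D.adj₁'.ne
  have ht₁P : t₁ ∉ P := fun h => (D.mem_piece h).2.2.2.2.1 rfl
  have hnP : ∀ u ∈ W, u ∉ P → u ≠ x → u ≠ s → u ≠ c → ∀ w ∈ P, ¬ G.Adj u w :=
    fun _ hu h1 h2 h3 h4 _ hw => D.not_adj_piece hu h1 h2 h3 h4 hw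
  obtain ⟨v, hv⟩ := D.nonempty
  have hPv := D.mem_piece hv
  have hroot : Rooted G (W \ insert c P) x s := by
    refine .of_forall (by grind) (by grind) hsx.symm fun A d u hsub hx' hs' hd' hu hcl => ?_
    have hN : ∀ a ∈ A, ∀ w ∈ W, G.Adj a w → w ∈ A ∨ w = c ∨ w = d := by
      intro a ha w hw haw
      have h1 := hcl a ha w
      have h2 := hnP a (by grind) (by grind) (by grind) (by grind) (by grind) w
      grind
    have hAW : A ⊆ W := hsub.trans Finset.sdiff_subset
    have hcA : c ∉ A := by grind
    by_cases hsd : s = d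
    · exact C.symm.false_of_sub' hAW hcA hx' hu hd' hN hPv.1 (by grind) hPv.2.2.1 hPv.2.1
        (by grind)
    · exact C.symm.false_of_sub' hAW hcA hx' hu hd' hN hsW hs' hcs.2.2.1.symm hsx hsd
  have h1 : Adm G (W \ insert c P) x s (k - 1) := by
    refine C.adm_pred hroot Finset.sdiff_subset hyW (by simp) (v := t₁) (by grind) hxt.symm
      hst.symm fun u hu hux hus => ⟨hux, by grind, c, fun w hw huw => ?_⟩
    have := hnP u (by grind) (by grind) hux hus (by grind) w
    grind
  have h2 := D.adm_s C
  have h3 := C.three_le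
  exact C.not_adm (h1.join h2 (by grind) Finset.sdiff_subset (by grind [D.mem_piece]) (by omega)
    (by omega) (by omega))

lemma false_of_adm_two (hB : B ⊆ W \ insert x P) (h : Adm G B c y 2) : False := by
  have hyP := D.y_notMem
  have hxy := C.ne
  have hk := C.three_le
  have hBW := hB.trans Finset.sdiff_subset
  have hPW : P ∪ {x, c} ⊆ W := by
    have h1 := C.x_mem
    have h2 := D.c_spec.1
    have h3 := fun u hu => (D.mem_piece (u := u) hu).1
    grind
  refine C.not_adm ((D.adm_x C).join h (by grind) hPW hBW (by omega) (by omega) (by omega))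

lemma false_of_rooted (hB : B ⊆ W \ insert x P) (h : Rooted G B c y) (hv : v ∈ B) (hvc : v ≠ c)
    (hvy : v ≠ y) (hvz : v ≠ z)
    (hN : ∀ u ∈ B, u ≠ c → u ≠ y → u ≠ z → ∀ w ∈ W, G.Adj u w → w ∈ B ∨ w = x) : False := by
  refine D.false_of_adm_two C hB (twoPaths (B.card + 1) G B c y z (by omega) h
    ⟨v, hv, hvc, hvy, hvz⟩ fun u hu huc huy huz => ?_)
  have h1 := C.deg u (Finset.mem_sdiff.1 (hB hu)).1 (by grind) huy
  have h2 := nbr_card_le_add (G := G) (W := W) (v := u) (A := B) (B := {x})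
    fun w hw huw => by simpa using hN u hu huc huy huz w hw huw
  rw [Finset.card_singleton] at h2
  have := C.three_le
  omega

lemma false_of_hang (hA : A ⊆ W \ insert x P) (hc : c ∉ A) (hy : y ∉ A) (hs : s ∉ A)
    (hd : d ∉ A) (hv : v ∈ A)
    (hN : ∀ a ∈ A, ∀ w ∈ W \ insert x P, G.Adj a w → w ∈ A ∨ w = d) : False := by
  have hN' : ∀ a ∈ A, ∀ w ∈ W, G.Adj a w → w ∈ A ∨ w = x ∨ w = d := by
    intro a ha w hw haw
    have h0 := hA ha
    have h1 := hN a ha w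
    rw [Finset.mem_sdiff, Finset.mem_insert, not_or] at h0 h1
    by_cases hwP : w ∈ P
    · exact absurd haw (D.not_adj_piece h0.1 h0.2.2 h0.2.1 (by grind) (by grind) hwP)
    · tauto
  have hAW := hA.trans Finset.sdiff_subset
  have hxA : x ∉ A := by grind
  by_cases hsd : s = d
  · have := D.c_spec
    exact C.false_of_sub' hAW hxA hy hv hd hN' this.1 hc this.2.1 (D.c_ne_y C) (by grind)
  · exact C.false_of_sub' hAW hxA hy hv hd hN' D.s_mem hs D.s_ne_x D.s_ne_y hsd

lemma exists_hang : ∃ A d, A ⊆ W \ insert x P ∧ c ∉ A ∧ y ∉ A ∧ d ∉ A ∧ s ∈ A ∧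
    (∀ a ∈ A, ∀ w ∈ W \ insert x P, G.Adj a w → w ∈ A ∨ w = d) ∧
    Rooted G ((W \ insert x P) \ A) c y := by
  have hcy := D.c_ne_y C
  have hcs := D.c_spec
  have hyW := C.y_mem
  have hyP := D.y_notMem
  have hcP := D.c_notMem
  have hxy := C.ne
  have hcB : c ∈ W \ insert x P := by grind
  have hyB : y ∈ W \ insert x P := by grind
  obtain ⟨d, hmax⟩ := exists_max_bad G (W \ insert x P) c y
  have hAB := bad_subset (G := G) (W := W \ insert x P) (x := c) (y := y) (d := d)
  have hcA := left_notMem_bad (G := G) (W := W \ insert x P) (x := c) (y := y) (d := d)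
  have hyA := right_notMem_bad (G := G) (W := W \ insert x P) (x := c) (y := y) (d := d)
  have hdA := self_notMem_bad (G := G) (W := W \ insert x P) (x := c) (y := y) (d := d)
  have hcl : ∀ a ∈ bad G (W \ insert x P) c y d, ∀ w ∈ W \ insert x P, G.Adj a w →
    w ∈ bad G (W \ insert x P) c y d ∨ w = d := fun a ha w hw haw => bad_closed hcy ha hw haw
  rcases (bad G (W \ insert x P) c y d).eq_empty_or_nonempty with hE | ⟨v, hv⟩
  · exfalso
    have hr : Rooted G (W \ insert x P) c y := by
      refine .of_bad hcB hyB hcy fun d' => ?_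
      have := hmax d'
      rw [hE] at this
      simpa using this
    have hst := D.adj₁'.ne
    have hxt := D.adj₁.ne
    have ht : ∀ u ∈ P, u ≠ t₁ := fun u hu => (D.mem_piece hu).2.2.2.2.1
    have htW := D.t₁_mem
    have hty : t₁ ≠ y := by
      rintro rfl
      exact C.not_adj D.adj₁
    refine D.false_of_rooted C (z := s) (v := t₁) subset_rfl hr (by grind) hcs.2.2.2.1.symm hty
      hst.symm fun u hu huc huy hus w hw huw => ?_
    have := D.not_adj_piece (u := u) (w := w) (by grind) (by grind) (by grind) hus huc
    grind
  · set A := bad G (W \ insert x P) c y d with hAdef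
    have hsA : s ∈ A := by
      by_contra hsA
      exact D.false_of_hang C hAB hcA hyA hsA hdA hv hcl
    refine ⟨A, d, hAB, hcA, hyA, hdA, hsA, hcl, .of_forall (by grind) (by grind) hcy ?_⟩
    intro A' d' v hA' hcA' hyA' hdA' hvA' hcl'
    have hdis : ∀ u ∈ A', u ∈ W \ insert x P ∧ u ∉ A := fun u hu => Finset.mem_sdiff.1 (hA' hu)
    by_cases hdA'' : d ∈ A'
    · have hlt : A.card < (A ∪ A').card :=
        Finset.card_lt_card ⟨Finset.subset_union_left, fun h => (hdis v hvA').2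
          (h (Finset.mem_union_right _ hvA'))⟩
      have hxA : x ∉ A ∪ A' := by grind
      have hsub : A ∪ A' ⊆ bad G (W \ insert x P) c y (if d' ∈ A then x else d') := by
        refine subset_bad (Finset.union_subset hAB fun u hu => (hdis u hu).1) (by grind)
          (by grind) (by split_ifs <;> grind) fun a ha w hw haw => ?_
        rcases Finset.mem_union.1 ha with h | h
        · have := hcl a h w hw haw
          grind
        · have := hcl' a h w
          split_ifs <;> grind
      have := Finset.card_le_card hsub
      have := hmax (if d' ∈ A then x else d')
      omega
    · refine D.false_of_hang C (fun u hu => (hdis u hu).1) hcA' hyA' (fun h => (hdis s h).2 hsA)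
        hdA' hvA' fun a ha w hw haw => ?_
      by_cases hwA : w ∈ A
      · have := hcl w hwA a (hdis a ha).1 haw.symm
        grind
      · exact hcl' a ha w (Finset.mem_sdiff.2 ⟨hw, hwA⟩) haw

variable (hA : A ⊆ W \ insert x P) (hcA : c ∉ A) (hyA : y ∉ A) (hdA : d ∉ A) (hsA : s ∈ A)
  (hcl : ∀ a ∈ A, ∀ w ∈ W \ insert x P, G.Adj a w → w ∈ A ∨ w = d)

include hA hcA hyA hdA hcl

lemma eq_of_notMem (hr : Rooted G ((W \ insert x P) \ A) c y) (hsA : s ∈ A) (hw : w ∈ W)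
    (hwA : w ∉ A) (hwx : w ≠ x) (hwP : w ∉ P) : w = c ∨ w = y ∨ w = d := by
  by_contra! hcon
  refine D.false_of_rooted C (z := d) (v := w) Finset.sdiff_subset hr (by grind) hcon.1 hcon.2.1
    hcon.2.2 fun u hu huc huy hud v hv huv => ?_
  simp only [Finset.mem_sdiff, Finset.mem_insert, not_or] at hu ⊢
  by_cases hvA : v ∈ A
  · have := hcl v hvA u (by simp [hu]) huv.symm
    tauto
  · have := D.not_adj_piece (u := u) (w := v) hu.1.1 hu.1.2.2 hu.1.2.1 (by grind) huc
    tauto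

lemma hang_closed (ha : a ∈ A) (hw : w ∈ W) (haw : G.Adj a w) :
    w ∈ A ∨ w = x ∨ w = d ∨ a = s ∧ w ∈ P := by
  have h0 := hA ha
  have h1 := hcl a ha w
  rw [Finset.mem_sdiff, Finset.mem_insert, not_or] at h0 h1
  by_cases has : a = s
  · tauto
  · have hac : a ≠ c := by rintro rfl; exact hcA ha
    have := D.not_adj_piece (u := a) (w := w) h0.1 h0.2.2 h0.2.1 has hac
    tauto

include hsA

lemma hang_ne : d ≠ c := by
  rintro rfl
  have hyP := D.y_notMem
  have hxP := D.x_notMem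
  have hcP := D.c_notMem
  have hyd := D.c_ne_y C
  have hd := D.c_spec
  refine C.false_of_sub (A := A ∪ P) (q := d) (w := y) (v := s) ?_ (by grind) (by grind)
    (by grind) hd.1 (by grind) hd.2.1 (fun a ha w hw haw => ?_) C.y_mem (by grind) C.ne.symm
    hyd.symm
  · exact Finset.union_subset (hA.trans Finset.sdiff_subset) fun u hu => (D.mem_piece hu).1
  · rw [Finset.mem_union] at ha ⊢
    rcases ha with ha | ha
    · have := D.hang_closed C hA hcA hyA hdA hcl ha hw haw
      tauto
    · have := D.closed a ha w hw haw
      have : w = s → w ∈ A := by rintro rfl; exact hsA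
      tauto

lemma hang_adj (hr : Rooted G ((W \ insert x P) \ A) c y) (hd : d ∈ W \ insert x P)
    (hdy : d ≠ y) : G.Adj d y := by
  by_contra hnot
  have hyP := D.y_notMem
  have hxP := D.x_notMem
  have hcP := D.c_notMem
  have hcy := D.c_ne_y C
  have hc := D.c_spec
  have hdc := D.hang_ne C hA hcA hyA hdA hsA hcl
  have hd' := Finset.mem_sdiff.1 hd
  refine C.false_of_sub (A := insert d (A ∪ P)) (q := c) (w := y) (v := s) ?_ (by grind) (by grind)
    (by grind) hc.1 (by grind) hc.2.1 (fun a ha w hw haw => ?_) C.y_mem (by grind) C.ne.symm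
    hcy.symm
  · refine Finset.insert_subset hd'.1 ?_
    exact Finset.union_subset (hA.trans Finset.sdiff_subset) fun u hu => (D.mem_piece hu).1
  · rw [Finset.mem_insert, Finset.mem_union] at ha ⊢
    rcases ha with rfl | ha | ha
    · have := D.eq_of_notMem C hA hcA hyA hdA hcl hr hsA hw
      have : w ≠ y := by rintro rfl; exact hnot haw
      tauto
    · have := D.hang_closed C hA hcA hyA hdA hcl ha hw haw
      tauto
    · have := D.closed a ha w hw haw
      have : w = s → w ∈ A := by rintro rfl; exact hsA
      tauto

lemma exists_hang_adj : ∃ t ∈ A, G.Adj x t ∧ G.Adj s t := by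
  by_contra! hcon
  have h : ∀ t ∈ W, G.Adj x t → G.Adj s t → t ∉ P → t = d := by
    intro t ht hxt hst htP
    have := D.hang_closed C hA hcA hyA hdA hcl hsA ht hst
    have := hcon t
    have : t ≠ x := hxt.ne'
    tauto
  refine D.ne ((h t₁ D.t₁_mem D.adj₁ D.adj₁' fun h => (D.mem_piece h).2.2.2.2.1 rfl).trans
    (h t₂ D.t₂_mem D.adj₂ D.adj₂' fun h => (D.mem_piece h).2.2.2.2.2 rfl).symm)

lemma reach_hang (hv : v ∈ A) : ReachIn G (insert x A) v x := by
  have hAW := hA.trans Finset.sdiff_subset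
  have hxA : x ∉ A := by grind
  by_cases hvd : v = d
  · exact absurd (hvd ▸ hv) hdA
  obtain ⟨b, hb, w, hw, hwA, hwd, hbw, hr⟩ := C.rooted.exit (d := d) hAW hxA hyA hv hvd
  have hr' : ReachIn G (insert x A) v b := hr.mono (by grind)
  have := D.hang_closed C hA hcA hyA hdA hcl hb hw hbw
  rcases this with h | rfl | h | ⟨rfl, -⟩
  · exact absurd h hwA
  · exact hr'.tail hbw (by simp)
  · exact absurd h hwd
  · obtain ⟨t, ht, hxt, hst⟩ := D.exists_hang_adj C hA hcA hyA hdA hsA hcl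
    exact (hr'.tail hst (by simp [ht])).tail hxt.symm (by simp)

lemma hang_rooted (hr : Rooted G ((W \ insert x P) \ A) c y) : Rooted G (insert x A) x s := by
  have hAW := hA.trans Finset.sdiff_subset
  have hxA : x ∉ A := by grind
  have hcs := D.c_spec
  refine .of_forall (by simp) (by simp [hsA]) D.s_ne_x.symm ?_
  intro A' d' v hA' hx' hs' hd' hv hcl'
  have hA'A : A' ⊆ A := (Finset.subset_insert_iff_of_notMem hx').1 hA'
  have hA'W := hA'A.trans hAW
  have hy' : y ∉ A' := fun h => hyA (hA'A h)
  have hc' : c ∉ A' := fun h => hcA (hA'A h)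
  have hN : ∀ a ∈ A', ∀ w ∈ W, G.Adj a w → w ∈ A' ∨ w = d' ∨ w = d ∧ d ∈ W \ insert x P := by
    intro a ha w hw haw
    have h4 : a ≠ s := by rintro rfl; exact hs' ha
    by_cases hwA : w ∈ insert x A
    · exact (hcl' a ha w hwA haw).imp_right .inl
    rw [Finset.mem_insert, not_or] at hwA
    rcases D.hang_closed C hA hcA hyA hdA hcl (hA'A ha) hw haw with h | h | rfl | h
    · exact absurd h hwA.2
    · exact absurd h hwA.1
    · refine .inr (.inr ⟨rfl, Finset.mem_sdiff.2 ⟨hw, ?_⟩⟩)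
      rw [Finset.mem_insert, not_or]
      exact ⟨hwA.1, fun h => D.not_adj_piece (hA'W ha) (by grind) (by grind) h4
        (by rintro rfl; exact hc' ha) h haw⟩
    · exact absurd h.1 h4
  by_cases hd : d ∈ W \ insert x P ∧ d ≠ y
  · by_cases hd'A : d' ∈ A
    · have hd₁ := Finset.mem_sdiff.1 hd.1
      have hdd : d' ≠ d := by rintro rfl; exact hdA hd'A
      have hdx : d ≠ x := by grind
      have h1 := C.adm_sub (p := d') (q := d) (w := x) hA'W hx' hy' hv (hAW hd'A) hd₁.1 hd'
        (fun h => hdA (hA'A h)) hdd (fun a ha w hw haw => by have := hN a ha w hw haw; tauto)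
        C.x_mem hx' (by rintro rfl; exact hxA hd'A) hdx.symm
      have h2 := D.hang_adj C hA hcA hyA hdA hsA hcl hr hd.1 hd.2
      have h3 : ReachIn G (insert x A \ A') x d' :=
        (D.reach_hang C hA hcA hyA hdA hsA hcl hd'A).symm.avoid_hanging hx' hd' hcl'
      have h4 : Adm G (insert x A ∪ {d}) x d k := by
        refine h3.then_adm h1 ?_ ?_ ?_
        · clear hN hcl' hcl hr h1 h2 h3
          grind
        · clear hN hcl' hcl hr h1 h2 h3
          grind
        · clear hN hcl' hcl hr h1 h2 h3
          grind
      have h5 : ReachIn G {d, y} d y := .head (by simp) h2 (.refl (by simp))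
      have hxW := C.x_mem
      have hyW := C.y_mem
      have hxy := C.ne
      refine C.not_adm (h4.then_reach h5 ?_ ?_ ?_)
      · clear hN hcl' hcl hr h1 h2 h3
        grind
      · clear hN hcl' hcl hr h1 h2 h3
        grind
      · clear hN hcl' hcl hr h1 h2 h3
        grind
    · refine C.false_of_sub' (q := d) (w := s) hA'W hx' hy' hv (fun h => hdA (hA'A h))
        (fun a ha w hw haw => ?_) D.s_mem hs' D.s_ne_x D.s_ne_y (by rintro rfl; exact hdA hsA)
      rcases hN a ha w hw haw with h | rfl | h
      · exact .inl h
      · rcases D.hang_closed C hA hcA hyA hdA hcl (hA'A ha) hw haw with h | h | h | h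
        · exact absurd h hd'A
        · exact .inr (.inl h)
        · exact .inr (.inr h)
        · exact absurd (h.1 ▸ ha) hs'
      · exact .inr (.inr h.1)
  · have hN' : ∀ a ∈ A', ∀ w ∈ W, G.Adj a w → w ∈ A' ∨ w = y ∨ w = d' := by
      intro a ha w hw haw
      rcases hN a ha w hw haw with h | h | ⟨rfl, h⟩ <;> tauto
    by_cases hsd : s = d'
    · exact C.symm.false_of_sub' hA'W hy' hx' hv hd' hN' hcs.1 hc' (D.c_ne_y C) hcs.2.1
        (by rw [← hsd]; exact hcs.2.2.1)
    · exact C.symm.false_of_sub' hA'W hy' hx' hv hd' hN' D.s_mem hs' D.s_ne_y D.s_ne_x hsd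

lemma false_of_max_hang (hr : Rooted G ((W \ insert x P) \ A) c y) : False := by
  have hAW := hA.trans Finset.sdiff_subset
  have hxA : x ∉ A := by grind
  have hxW := C.x_mem
  have hcs := D.c_spec
  have hk := C.three_le
  obtain ⟨t, ht, hxt, hst⟩ := D.exists_hang_adj C hA hcA hyA hdA hsA hcl
  have h1 : Adm G (insert x A) x s (k - 1) := by
    refine C.adm_pred (D.hang_rooted C hA hcA hyA hdA hsA hcl hr) (Finset.insert_subset hxW hAW)
      hcs.1 (by grind) (v := t) (by simp [ht]) hxt.ne' hst.ne' fun u hu hux hus => ?_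
    have huA : u ∈ A := by simpa [hux] using hu
    refine ⟨hux, by grind, d, fun w hw huw => ?_⟩
    have := D.hang_closed C hA hcA hyA hdA hcl huA hw huw
    rw [Finset.mem_insert]
    tauto
  have hPA : ∀ u ∈ P, u ∉ A := fun u hu h => by grind
  have hxP := D.x_notMem
  have hPW : P ⊆ W := fun u hu => (D.mem_piece hu).1
  have h2 : Adm G (insert x A ∪ (P ∪ {s, c})) x c k :=
    h1.join (D.adm_s C) (by grind) Finset.subset_union_left
      Finset.subset_union_right (by omega) (by omega) (by omega)
  have h3 : ReachIn G ((W \ (P ∪ {x, s, t₁, t₂})) \ A) c y := by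
    refine D.to_y.avoid_hanging hcA hyA (d := d) fun a ha w hw haw => ?_
    have := D.hang_closed C hA hcA hyA hdA hcl ha (Finset.mem_sdiff.1 hw).1 haw
    have := Finset.mem_sdiff.1 hw
    grind
  refine C.not_adm (h2.then_reach h3 ?_ ?_ ?_)
  · clear hcl hr h1 h2 h3
    grind
  · have := D.s_mem
    clear hcl hr h1 h2 h3
    grind
  · clear hcl hr h1 h2 h3
    grind

end Square

namespace Critical

variable (C : Critical G W x y k)

include C

lemma false_of_square (D : Square G W x y s t₁ t₂ P c) : False := by
  obtain ⟨A, d, hA, hcA, hyA, hdA, hsA, hcl, hr⟩ := D.exists_hang C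
  exact D.false_of_max_hang C hA hcA hyA hdA hsA hcl hr

end Critical

end SquareCores

section ManyPathsMain

variable {V : Type*} [DecidableEq V]
variable {G G' : SimpleGraph V} {W A B Z E H K P Q S T U : Finset V}
  {a b c d e p q r s t t' t₁ t₂ u v w x y z : V} {k l m n N : ℕ}

namespace Critical

variable (C : Critical G W x y k)

include C

lemma false_of_bip_frame (D : Bip G W x y S T) (F : Frame G W x y (insert x (S ∪ T)) U b)
    (hr : r ∈ U) (hbr : G.Adj b r)
    (hfull : ∀ u ∈ U, u ≠ b → G.Adj x u → ∃ s ∈ S, ¬ G.Adj s u)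
    (hmax : ∀ u ∈ U, u ≠ b → u ≠ x → u ≠ y → (nbr G T u).card ≤ S.card + 1) : False := by
  obtain ⟨P, c, M⟩ := F.exists_minPiece hr hbr
  have hUb : ∀ u ∈ P, u ∈ U ∧ u ≠ b := fun u hu =>
    ⟨Finset.mem_of_mem_erase (M.subset hu), Finset.ne_of_mem_erase (M.subset hu)⟩
  have hnT := C.bip_not_touch D F M hfull hmax
  obtain ⟨t₁, ht₁⟩ := Finset.card_pos.1 (by have := D.lt; omega : 0 < T.card)
  obtain ⟨u, hu, f, hf, hfx, hfu⟩ := C.exists_touch F M (e := t₁) (by simp [ht₁])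
    (D.right t₁ ht₁).2.1.ne'
  have hfS : f ∈ S := by
    have := hnT u hu f
    simp only [Finset.mem_insert, Finset.mem_union] at hf
    tauto
  rcases Nat.lt_or_ge S.card 2 with hS | hS
  · have hS1 : S.card = 1 := by
      have := Finset.card_pos.2 ⟨f, hfS⟩
      omega
    obtain ⟨s, rfl⟩ := Finset.card_eq_one.1 hS1
    obtain ⟨t₁, t₂, hsq⟩ := C.square_of_piece D F M hnT
    exact C.false_of_square hsq
  · refine C.not_touch F M (E := S) (e := f) (l := S.card - 1) (by grind) hfS hfx
      ⟨2, 2, .inr rfl, fun e he i hi => D.path' he (by omega)⟩ (fun u hu => ?_) u hu f hfS hfu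
    have hnT' := hnT u hu
    have huU := hUb u hu
    clear hnT
    by_cases huS : ∃ e ∈ S, G.Adj e u
    · refine .inr ⟨huS, ?_⟩
      rw [Nat.sub_add_cancel (by omega)]
      by_cases hux : G.Adj x u
      · obtain ⟨s, hs, hsu⟩ := hfull u huU.1 huU.2 hux
        have h9 : (nbr G S u).card + 1 ≤ S.card := nbr_card_lt hs fun h => hsu h.symm
        have h10 : (nbr G (insert x (S ∪ T)) u).card ≤ (insert x (nbr G S u)).card := by
          refine nbr_card_le_of_subset fun w hw huw => ?_
          have := hnT' w
          have := huw.symm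
          rw [Finset.mem_insert, mem_nbr]
          simp only [Finset.mem_insert, Finset.mem_union] at hw
          tauto
        exact h10.trans ((Finset.card_insert_le _ _).trans h9)
      · refine nbr_card_le_of_subset fun w hw huw => ?_
        have := hnT' w
        have := huw.symm
        simp only [Finset.mem_insert, Finset.mem_union] at hw
        rcases hw with rfl | hw | hw <;> tauto
    · left
      have h10 : (nbr G (insert x (S ∪ T)) u).card ≤ ({x} : Finset V).card := by
        refine nbr_card_le_of_subset fun w hw huw => ?_
        have := hnT' w
        have := huw.symm
        simp only [Finset.mem_insert, Finset.mem_union] at hw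
        rw [Finset.mem_singleton]
        by_contra hwx
        exact huS ⟨w, by tauto, this⟩
      simp only [Finset.card_singleton] at h10
      omega

lemma bip_notMem (D : Bip G W x y S T) : y ∉ insert x (S ∪ T) := by
  intro hy
  simp only [Finset.mem_insert, Finset.mem_union] at hy
  rcases hy with hy | hy | hy
  · exact C.ne hy.symm
  · exact (D.left y hy).2.2 rfl
  · exact C.not_adj (D.right y hy).2.1

lemma nbr_mem_bip (D : Bip G W x y S (common G W x S))
    (hmax : ∀ S' T', Bip G W x y S' T' → S'.card ≤ S.card) (hr : r ∈ W) (hyr : G.Adj y r) :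
    r ∈ S ∨ r ∈ common G W x S := by
  by_contra hcon
  have hrx : r ≠ x := by
    rintro rfl
    exact C.not_adj hyr.symm
  refine C.false_of_bip_frame D (.of_right (D.subset C.x_mem) (by simp) C.y_mem
    (C.bip_notMem D)) (r := r) ?_ hyr ?_ ?_
  · simp only [Finset.mem_sdiff, Finset.mem_insert, Finset.mem_union]
    tauto
  · intro u hu _ hxu
    by_contra! h
    simp only [Finset.mem_sdiff, Finset.mem_insert, Finset.mem_union, mem_common] at hu
    tauto
  · intro u hu _ hux huy
    simp only [Finset.mem_sdiff, Finset.mem_insert, Finset.mem_union] at hu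
    exact D.card_nbr_le hmax hu.1 hux huy (by tauto)

lemma nbr_mem_common (D : Bip G W x y S (common G W x S))
    (hmax : ∀ S' T', Bip G W x y S' T' → S'.card ≤ S.card) (hb : b ∈ common G W x S)
    (hyb : G.Adj y b) (hr : r ∈ W) (hyr : G.Adj y r) : r ∈ common G W x S := by
  refine (C.nbr_mem_bip D hmax hr hyr).resolve_left fun hrS => ?_
  rw [mem_common] at hb
  exact C.symm.not_triangle hb.1 hr hyb hyr (hb.2.2 r hrS).symm

lemma card_le_of_bip_notMem (D : Bip G W x y S T)
    (hmax : ∀ S' T', Bip G W x y S' T' → S'.card ≤ S.card) (hb : b ∈ W) (hyb : G.Adj y b)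
    (hbS : b ∉ S) : b ∈ T := by
  by_contra hbT
  have D' := D.of_common
  have hbC := (C.nbr_mem_bip D' hmax hb hyb).resolve_left hbS
  have hyN := fun r hr hyr => C.nbr_mem_common D' hmax hbC hyb (r := r) hr hyr
  have hbx : G.Adj x b := (mem_common.1 hbC).2.1
  have hsub := D'.subset C.x_mem
  have hynot := C.bip_notMem D'
  have hlt := D.lt
  set K := common G W x S with hK
  have hDb : Bip G W x y S (K.erase b) := by
    refine ⟨D.left, fun t ht => D'.right t (Finset.mem_of_mem_erase ht), hlt.trans_le ?_⟩
    refine Finset.card_le_card fun t ht => Finset.mem_erase.2 ⟨?_, D.subset_common ht⟩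
    rintro rfl
    exact hbT ht
  by_cases hk : S.card + 1 < k
  · obtain ⟨r, hr, hbr, hrS⟩ := C.exists_adj_notMem (S := insert x (insert y S)) hb hbx.ne' hyb.ne'
      ((Finset.card_insert_le _ _).trans ((Nat.succ_le_succ (Finset.card_insert_le _ _)).trans
        (by omega)))
    have hrK : r ∉ K := fun h =>
      C.not_triangle hb hr hbx (mem_common.1 h).2.1 hbr
    have hbS' : b ∉ insert x (S ∪ K.erase b) := by
      have := hbx.ne'
      simp only [Finset.mem_insert, Finset.mem_union, Finset.mem_erase]
      tauto
    refine C.false_of_bip_frame hDb (.of_adj (hDb.subset C.x_mem) (by simp) (C.bip_notMem hDb) hb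
      hbS' hyb ?_) (r := r) ?_ hbr ?_ ?_
    · intro w hw hyw
      have := hyN w hw hyw
      simp only [Finset.mem_insert, Finset.mem_union, Finset.mem_erase]
      tauto
    · simp only [Finset.mem_sdiff, Finset.mem_insert, Finset.mem_union, Finset.mem_erase] at hrS ⊢
      tauto
    · intro u hu hub hxu
      by_contra! h
      have : u ∈ K := mem_common.2 ⟨by simp at hu; tauto, hxu, h⟩
      simp only [Finset.mem_sdiff, Finset.mem_insert, Finset.mem_union, Finset.mem_erase] at hu
      tauto
    · intro u hu _ hux huy
      simp only [Finset.mem_sdiff, Finset.mem_insert, Finset.mem_union, Finset.mem_erase] at hu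
      exact hDb.card_nbr_le hmax hu.2.1 hux huy (by tauto)
  · refine C.not_adm (Adm.then_reach (A := insert x (S ∪ K)) (B := {b, y}) (v := b)
      ⟨1, 2, .inr rfl, fun i hi => D'.path hbC (by omega)⟩ ⟨1, .adj hyb.symm⟩ ?_ hsub ?_)
    · intro a ha hab
      simp only [Finset.mem_insert, Finset.mem_singleton] at hab
      rcases hab with rfl | rfl
      · rfl
      · exact absurd ha hynot
    · have := C.y_mem
      grind

lemma nbr_mem_left (D : Bip G W x y S (common G W x S))
    (hmax : ∀ S' T', Bip G W x y S' T' → S'.card ≤ S.card) (hb : b ∈ W) (hyb : G.Adj y b) :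
    b ∈ S := by
  by_contra hbS
  have hbC := C.card_le_of_bip_notMem D hmax hb hyb hbS
  have hyN := fun r hr hyr => C.nbr_mem_common D hmax hbC hyb (r := r) hr hyr
  have hbx : G.Adj x b := (mem_common.1 hbC).2.1
  have hlt := D.lt
  obtain ⟨s, hs⟩ : S.Nonempty := by
    rw [Finset.nonempty_iff_ne_empty]
    rintro rfl
    refine C.symm.false_of_pendant (b := b) fun w hw hxw => ?_
    by_contra hwb
    have hD : Bip G W x y ∅ {w} := ⟨by simp, by simp [hw, hxw], by simp⟩
    have := C.card_le_of_bip_notMem hD hmax hb hyb (by simp)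
    simp at this
    exact hwb this.symm
  have hsW := D.left s hs
  have hsb := (mem_common.1 hbC).2.2 s hs
  have hcard := Finset.card_erase_of_mem hs
  have hpos := Finset.card_pos.2 ⟨s, hs⟩
  set K := common G W x (S.erase s) with hK
  have hDb : Bip G W x y (S.erase s) (K.erase b) := by
    refine ⟨fun s hs => D.left s (Finset.mem_of_mem_erase hs),
      fun t ht => mem_common.1 (Finset.mem_of_mem_erase ht), ?_⟩
    have h1 : (common G W x S).erase b ⊆ K.erase b := by
      refine Finset.erase_subset_erase _ fun t ht => ?_
      rw [mem_common] at ht ⊢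
      exact ⟨ht.1, ht.2.1, fun s hs => ht.2.2 s (Finset.mem_of_mem_erase hs)⟩
    have h2 := Finset.card_le_card h1
    rw [Finset.card_erase_of_mem hbC] at h2
    omega
  have hbS' : b ∉ insert x (S.erase s ∪ K.erase b) := by
    have := hbx.ne'
    simp only [Finset.mem_insert, Finset.mem_union, Finset.mem_erase]
    tauto
  refine C.false_of_bip_frame hDb (.of_adj (hDb.subset C.x_mem) (by simp) (C.bip_notMem hDb) hb
    hbS' hyb ?_) (r := s) ?_ hsb.symm ?_ ?_
  · intro w hw hyw
    have h1 := mem_common.1 (hyN w hw hyw)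
    have h2 : w ∈ K := mem_common.2 ⟨hw, h1.2.1, fun s hs => h1.2.2 s (Finset.mem_of_mem_erase hs)⟩
    simp only [Finset.mem_insert, Finset.mem_union, Finset.mem_erase]
    tauto
  · have hsK : s ∉ K := fun h => C.not_triangle hb hsW.1 hbx (mem_common.1 h).2.1 hsb.symm
    simp only [Finset.mem_sdiff, Finset.mem_insert, Finset.mem_union, Finset.mem_erase]
    tauto
  · intro u hu hub hxu
    by_contra! h
    simp only [Finset.mem_sdiff, Finset.mem_insert, Finset.mem_union, Finset.mem_erase] at hu
    have : u ∈ K := mem_common.2 ⟨hu.2.1, hxu, h⟩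
    tauto
  · intro u hu hub hux huy
    by_contra! hcon
    simp only [Finset.mem_sdiff, Finset.mem_insert, Finset.mem_union, Finset.mem_erase] at hu
    have huS : u ∉ S.erase s := by
      simp only [Finset.mem_erase]
      tauto
    have hD := hDb.insert_left hu.2.1 hux huy huS hcon
    have hcard' : (insert u (S.erase s)).card = S.card := by
      rw [Finset.card_insert_of_notMem huS]
      omega
    have := C.card_le_of_bip_notMem hD (fun S' T' h => hcard' ▸ hmax S' T' h) hb hyb
      (by simp [hbS, hub.symm])
    simp at this

lemma exists_bip : ∃ S, Bip G W x y S (common G W x S) ∧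
    ∀ S' T', Bip G W x y S' T' → S'.card ≤ S.card := by
  classical
  obtain ⟨w, hw, hxw, -⟩ := C.exists_adj
  obtain ⟨S, h1, h2⟩ := Finset.exists_max_image
    (W.powerset.filter fun S => Bip G W x y S (common G W x S)) Finset.card
    ⟨∅, by
      simp only [Finset.mem_filter, Finset.mem_powerset, Finset.empty_subset, true_and]
      exact ⟨by simp, fun t ht => mem_common.1 ht,
        Finset.card_pos.2 ⟨w, mem_common.2 ⟨hw, hxw, by simp⟩⟩⟩⟩
  simp only [Finset.mem_filter, Finset.mem_powerset] at h1 h2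
  exact ⟨S, h1.2, fun S' T' h => h2 S' ⟨fun s hs => (h.left s hs).1, h.of_common⟩⟩

theorem contradiction : False := by
  obtain ⟨S, D, hmax⟩ := C.exists_bip
  obtain ⟨S', D', hmax'⟩ := C.symm.exists_bip
  have h1 : common G W y S' ⊆ S := fun t ht =>
    C.nbr_mem_left D hmax (mem_common.1 ht).1 (mem_common.1 ht).2.1
  have h2 : common G W x S ⊆ S' := fun t ht =>
    C.symm.nbr_mem_left D' hmax' (mem_common.1 ht).1 (mem_common.1 ht).2.1
  have := Finset.card_le_card h1
  have := Finset.card_le_card h2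
  have := D.lt
  have := D'.lt
  omega

end Critical

theorem pathsBelow (N : ℕ) : PathsBelow V N := by
  induction N with
  | zero => exact fun _ _ _ _ _ h => absurd h (by omega)
  | succ N ih =>
    rintro G W x y k hW h ⟨v, hv, hvx, hvy⟩ hdeg
    obtain ⟨G', hle, hxy, hG'⟩ := exists_deleteEdge G x y
    have h' := h.congr hG'
    have hdeg' : ∀ u ∈ W, u ≠ x → u ≠ y → k + 1 ≤ (nbr G' W u).card := fun u hu hux huy =>
      (hdeg u hu hux huy).trans
        (nbr_card_le fun w hw huw => ⟨hw, hG' u w (by grind) (by grind) huw⟩)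
    suffices hA : Adm G' W x y k from hA.congr fun a _ b _ hab => hle hab
    by_contra hno
    have h3 : 3 ≤ k := by
      by_contra hk
      refine hno (Adm.le (k := 2) ?_ (by omega))
      rcases Nat.lt_or_ge k 2 with hk2 | hk2
      · exact absurd (Adm.le (h'.adm_one hv hvx hvy) (by omega)) hno
      · refine twoPaths (W.card + 1) G' W x y x (by omega) h' ⟨v, hv, hvx, hvy, hvx⟩
          fun u hu hux huy _ => ?_
        have := hdeg' u hu hux huy
        omega
    exact Critical.contradiction (k := k) ⟨fun G W' x y k hW' => ih G W' x y k (by omega), h',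
      hdeg', hxy, h3, ⟨v, hv, hvx, hvy⟩, hno⟩

end ManyPathsMain

section Cuts

variable {V : Type*} [DecidableEq V] {G G' : SimpleGraph V} {A B S T W : Finset V}
  {d u v x y : V} {k m n r : ℕ}

lemma PathIn.hasCycleLen (p : PathIn G A x y m) (q : PathIn G B x y n) (hxy : x ≠ y)
    (hadj : ¬ G.Adj x y) (h : ∀ a ∈ A, a ∈ B → a = x ∨ a = y) : HasCycleLen G (m + n) := by
  obtain ⟨u, l, rfl, hxu, p'⟩ := p.exists_cons hxy
  have huy : u ≠ y := by
    rintro rfl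
    exact hadj hxu
  obtain ⟨_, _, rfl, -, -⟩ := p'.exists_cons huy
  obtain ⟨_, _, rfl, -, -⟩ := q.exists_cons hxy
  obtain ⟨w, hw, hl, -⟩ := (p'.join q.symm (by grind)).exists_walk
  refine ⟨x, .cons hxu w, (Walk.cons_isCycle_iff w hxu).2 ⟨hw, fun he => ?_⟩, ?_⟩
  · have := hw.length_eq_one_of_mem_edges (Sym2.eq_swap ▸ he)
    omega
  · rw [Walk.length_cons, hl]
    ring

variable [Fintype V]

lemma PathIn.reachable_induce (p : PathIn G A u v n) (hA : ∀ a ∈ A, a ∈ ((↑S : Set V)ᶜ)) :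
    (G.induce ((↑S : Set V)ᶜ)).Reachable ⟨u, hA u p.left_mem⟩ ⟨v, hA v p.right_mem⟩ := by
  induction p with
  | nil => exact .refl _
  | @cons A u w v n hu hadj p ih =>
    have hA' : ∀ a ∈ A.erase u, a ∈ ((↑S : Set V)ᶜ) := fun a ha => hA a (Finset.mem_of_mem_erase ha)
    exact (Adj.reachable (show (G.induce _).Adj ⟨u, hA u hu⟩ ⟨w, hA' w p.left_mem⟩ from hadj)).trans
      (ih hA')

lemma reachIn_of_reachable {u v : ((↑S : Set V)ᶜ : Set V)}
    (h : (G.induce ((↑S : Set V)ᶜ)).Reachable u v) : ReachIn G Sᶜ u v := by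
  obtain ⟨w⟩ := h
  have hmem : ∀ u : ((↑S : Set V)ᶜ : Set V), (u : V) ∈ Sᶜ := fun u =>
    Finset.mem_compl.2 u.2
  induction w with
  | nil => exact .refl (hmem _)
  | cons h w ih => exact .head (hmem _) h ih

/-- The set `S` separates two vertices. -/
def Separates (G : SimpleGraph V) (S : Finset V) : Prop :=
  ∃ u ∉ S, ∃ v ∉ S, ¬ ReachIn G Sᶜ u v

lemma IsVertexCut.separates (h : IsVertexCut G S) (hu : u ∉ S) : Separates G S := by
  unfold Separates
  by_contra! hcon
  refine h ((connected_iff _).2 ⟨?_, ⟨⟨u, by simpa using hu⟩⟩⟩)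
  rintro ⟨a, ha⟩ ⟨b, hb⟩
  obtain ⟨n, p⟩ := hcon a (by simpa using ha) b (by simpa using hb)
  exact p.reachable_induce (by simp)

lemma Separates.two_le_card (h : Separates G S) (h2 : KConnected G 2) : 2 ≤ S.card := by
  by_contra! hlt
  obtain ⟨u, hu, v, hv, hr⟩ := h
  exact hr (reachIn_of_reachable (u := ⟨u, by simpa using hu⟩) (v := ⟨v, by simpa using hv⟩)
    ((h2.2 S (by omega)).preconnected _ _))

lemma Separates.exists_min (h : Separates G S) :
    ∃ T, Separates G T ∧ T.card ≤ S.card ∧ ∀ T', Separates G T' → T.card ≤ T'.card := by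
  classical
  obtain ⟨T, hT, hmin⟩ := Finset.exists_min_image (Finset.univ.filter (Separates G)) Finset.card
    ⟨S, by simpa using h⟩
  simp only [Finset.mem_filter, Finset.mem_univ, true_and] at hT hmin
  exact ⟨T, hT, hmin S h, hmin⟩

lemma rooted_of_min_separator (hmin : ∀ T, Separates G T → S.card ≤ T.card) (hx : x ∈ S)
    (hy : y ∈ S) (hxy : x ≠ y) (hA : ∀ a ∈ A, ∀ w, G.Adj a w → w ∈ A ∨ w ∈ S)
    (hd : Disjoint A S) : Rooted G (insert x (insert y A)) x y := by
  refine .of_forall (by simp) (by simp) hxy fun A' d v hA' hxA' hyA' hdA' hv hcl => ?_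
  have hA'A : ∀ a ∈ A', a ∈ A := by grind
  have hdis : ∀ a ∈ A, a ∉ S := fun a ha => Finset.disjoint_left.1 hd ha
  obtain ⟨z, hz, hzd⟩ : ∃ z, (z = x ∨ z = y) ∧ z ≠ d := by
    by_cases h : x = d
    · exact ⟨y, .inr rfl, fun h' => hxy (h.trans h'.symm)⟩
    · exact ⟨x, .inl rfl, h⟩
  have hlt : (insert d ((S.erase x).erase y)).card < S.card := by
    have h1 := Finset.card_insert_le d ((S.erase x).erase y)
    have h2 : y ∈ S.erase x := by simp [hy, hxy.symm]
    have h3 := Finset.card_erase_of_mem h2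
    have h4 := Finset.card_erase_of_mem hx
    have h5 := Finset.card_pos.2 ⟨y, h2⟩
    omega
  refine absurd (hmin (insert d ((S.erase x).erase y)) ⟨v, ?_, z, ?_, fun hr => ?_⟩) (by omega)
  · have := hdis v (hA'A v hv)
    grind
  · grind
  · obtain ⟨b, hb, w, hw, hwA, hbw, -⟩ := hr.exists_exit hv (by grind)
    have h1 := hcl b hb w
    have h2 := hA b (hA'A b hb) w hbw
    simp only [Finset.mem_compl, Finset.mem_insert, Finset.mem_erase, not_or, not_and] at hw h1
    tauto

lemma adm_of_min_separator [DecidableRel G.Adj] (hmin : ∀ T, Separates G T → S.card ≤ T.card)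
    (hx : x ∈ S) (hy : y ∈ S) (hxy : x ≠ y)
    (hG : ∀ a b, ¬ (a = x ∧ b = y) → ¬ (a = y ∧ b = x) → G.Adj a b → G'.Adj a b)
    (hA : ∀ a ∈ A, ∀ w, G.Adj a w → w ∈ A ∨ w ∈ S) (hd : Disjoint A S) (hv : v ∈ A)
    (hdeg : ∀ v, m + S.card ≤ G.degree v + 1) : Adm G' (insert x (insert y A)) x y m := by
  have hdis : ∀ a ∈ A, a ∉ S := fun a ha => Finset.disjoint_left.1 hd ha
  have hne : ∀ a ∈ A, a ≠ x ∧ a ≠ y := fun a ha =>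
    ⟨by rintro rfl; exact hdis _ ha hx, by rintro rfl; exact hdis _ ha hy⟩
  refine pathsBelow _ G' _ x y m (Nat.lt_succ_self _)
    ((rooted_of_min_separator hmin hx hy hxy hA hd).congr hG) ⟨v, by simp [hv], hne v hv⟩
    fun u hu hux huy => ?_
  have huA : u ∈ A := by simpa [hux, huy] using hu
  have h1 : nbr G Finset.univ u = G.neighborFinset u := by
    ext w
    simp [mem_nbr]
  have h2 := nbr_card_le_add (G := G) (W := Finset.univ) (v := u) (A := insert x (insert y A))
    (B := (S.erase x).erase y) fun w _ huw => by
      have := hA u huA w huw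
      simp only [Finset.mem_insert, Finset.mem_erase]
      tauto
  rw [h1, card_neighborFinset_eq_degree] at h2
  have h3 : (nbr G (insert x (insert y A)) u).card ≤ (nbr G' (insert x (insert y A)) u).card :=
    nbr_card_le fun w hw huw => ⟨hw, hG u w (by tauto) (by tauto) huw⟩
  have h4 : y ∈ S.erase x := by simp [hy, hxy.symm]
  have h5 := Finset.card_erase_of_mem h4
  have h6 := Finset.card_erase_of_mem hx
  have h7 := Finset.card_pos.2 ⟨y, h4⟩
  have := hdeg u
  omega

lemma Separates.hasAdmissibleCycles [DecidableRel G.Adj] (h : Separates G S)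
    (h2 : KConnected G 2) (hdeg : ∀ v, m + S.card ≤ G.degree v + 1) (hm : 1 ≤ m)
    (hk : k ≤ m + m - 1) : HasAdmissibleCycles G k := by
  classical
  obtain ⟨T, hT, hTS, hmin⟩ := h.exists_min
  obtain ⟨x, hx, y, hy, hxy⟩ := Finset.one_lt_card.1 (hT.two_le_card h2)
  obtain ⟨u, hu, v, hv, hr⟩ := hT
  obtain ⟨G', hle, hadj, hG⟩ := exists_deleteEdge G x y
  have hdeg' : ∀ v, m + T.card ≤ G.degree v + 1 := fun v => by have := hdeg v; omega
  obtain ⟨A, hA⟩ : ∃ A : Finset V, ∀ w, w ∈ A ↔ ReachIn G Tᶜ u w :=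
    ⟨Finset.univ.filter (ReachIn G Tᶜ u), by simp⟩
  have hAT : ∀ a ∈ A, a ∉ T := fun a ha => Finset.mem_compl.1 ((hA a).1 ha).right_mem
  have hcl : ∀ a ∈ A, ∀ w, G.Adj a w → w ∈ A ∨ w ∈ T := by
    intro a ha w haw
    by_cases hw : w ∈ T
    · exact .inr hw
    · exact .inl ((hA w).2 (((hA a).1 ha).tail haw (Finset.mem_compl.2 hw)))
  have hB : ∀ a, a ∈ (A ∪ T)ᶜ ↔ a ∉ A ∧ a ∉ T := by simp
  have h₁ := adm_of_min_separator hmin hx hy hxy hG hcl (Finset.disjoint_left.2 hAT)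
    ((hA u).2 (.refl (Finset.mem_compl.2 hu))) hdeg'
  have h₂ := adm_of_min_separator (A := (A ∪ T)ᶜ) (v := v) hmin hx hy hxy hG
    (fun a ha w haw => by
      have := fun h => hcl w h a
      have := haw.symm
      rw [hB] at ha ⊢
      tauto)
    (Finset.disjoint_left.2 fun a ha => ((hB a).1 ha).2)
    ((hB v).2 ⟨fun h => hr ((hA v).1 h), hv⟩) hdeg'
  refine IsAdm.add (L := {n | HasCycleLen G n}) 0 h₁ h₂ (fun a ha b hb => ?_) hm hm hk
  have hdis : ∀ v ∈ insert x (insert y A), v ∈ insert x (insert y (A ∪ T)ᶜ) → v = x ∨ v = y := by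
    intro v hv hv'
    rw [Finset.mem_insert, Finset.mem_insert] at hv hv'
    have := hB v
    tauto
  obtain ⟨w, c, hc, hl⟩ := PathIn.hasCycleLen ha hb hxy hadj hdis
  exact ⟨w, c.mapLe hle, hc.mapLe hle, by simpa using hl⟩

end Cuts

/-- If a 2-connected graph with minimum degree at least `k - r`
(`k ≥ 2`, `r ≥ 0`) does not contain `k` admissible cycles, then every vertex cut `S`
satisfies `2|S| ≥ k + 2 - 2r`. -/
theorem stmt7 {V : Type*} [Fintype V] [DecidableEq V] (G : SimpleGraph V)
    [DecidableRel G.Adj] (k r : ℕ) (hk : 2 ≤ k)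
    (h2 : KConnected G 2) (hδ : ∀ v : V, k - r ≤ G.degree v)
    (hno : ¬ HasAdmissibleCycles G k) :
    ∀ S : Finset V, IsVertexCut G S → (k : ℤ) + 2 - 2 * r ≤ 2 * S.card := by
  intro S hS
  by_contra hlt
  by_cases hfull : ∃ u, u ∉ S
  · obtain ⟨u, hu⟩ := hfull
    have hsep := hS.separates hu
    have := hsep.two_le_card h2
    refine hno (hsep.hasAdmissibleCycles (m := k + 1 - r - S.card) h2 (fun v => ?_) ?_ ?_)
    · have := hδ v
      omega
    · omega
    · omega
  · push Not at hfull
    have h1 : S.card = Fintype.card V := by rw [Finset.eq_univ_iff_forall.2 hfull, Finset.card_univ]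
    have h3 := h2.1
    obtain ⟨v⟩ : Nonempty V := Fintype.card_pos_iff.1 (by omega)
    have h4 := hδ v
    have h5 := G.degree_lt_card_verts v
    omega
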